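/- arXiv:0808.3499 — 2 statements merged into one kernel-verified Lean document; each statement's English description precedes it below -/
import Mathlib

section
/- Assume condition (INV), and let D be a simply connected domain in ℂ containing the singularities p_0, …, p_{S+1}. Then for every ℂ^N-valued function g analytic on D there exists a unique polynomial φ ∈ ℂ^N[x] of degree at most S such that the corrected equation y'(x) + B(x) y(x) = Q(x)^{−1} [g(x) − φ(x)] has a solution y which is analytic on all of D. -/
section AuxPart

section P1
open Filter Topology

theorem aux_bdd_below {Y : Type*} [NormedAddCommGroup Y] [NormedSpace ℂ Y]
    (K : Y →L[ℂ] Y) (hK : IsCompactOperator K) (Z : Submodule ℂ Y) (hZ : IsClosed (Z : Set Y))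
    (hinj : ∀ z ∈ Z, z + K z = 0 → z = 0) :
    ∃ c : ℝ, 0 < c ∧ ∀ z ∈ Z, c * ‖z‖ ≤ ‖z + K z‖ := by
  by_contra! h
  have h1 : ∀ n : ℕ, ∃ z ∈ Z, ‖z‖ = 1 ∧ ‖z + K z‖ < 1 / ((n : ℝ) + 1) := by
    intro n
    obtain ⟨z, hz, hlt⟩ := h (1 / ((n : ℝ) + 1)) (by positivity)
    have hz0 : z ≠ 0 := by
      rintro rfl
      simp at hlt
    have hn : 0 < ‖z‖ := norm_pos_iff.2 hz0
    refine ⟨((‖z‖⁻¹ : ℝ) : ℂ) • z, Z.smul_mem _ hz, ?_, ?_⟩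
    · rw [norm_smul, Complex.norm_real, norm_inv, norm_norm, inv_mul_cancel₀ hn.ne']
    · rw [map_smul, ← smul_add, norm_smul, Complex.norm_real, norm_inv, norm_norm]
      rw [inv_mul_lt_iff₀ hn]
      linarith
  choose z hzZ hz1 hzlt using h1
  obtain ⟨C, hC, hKC⟩ := hK.image_closedBall_subset_compact (𝕜₁ := ℂ) 1
  have hmem : ∀ n, K (z n) ∈ C := fun n => hKC ⟨z n, by simp [hz1], rfl⟩
  obtain ⟨u, -, f, hf, hlim⟩ := hC.tendsto_subseq hmem
  have hS : Tendsto (fun n => z n + K (z n)) atTop (𝓝 0) :=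
    squeeze_zero_norm (fun n => (hzlt n).le) tendsto_one_div_add_atTop_nhds_zero_nat
  have hz : Tendsto (fun n => z (f n)) atTop (𝓝 (0 - u)) := by
    have := (hS.comp hf.tendsto_atTop).sub hlim
    refine this.congr fun n => ?_
    simp
  have hu : (0 - u) ∈ Z := hZ.mem_of_tendsto hz (Eventually.of_forall fun n => hzZ _)
  have h0 : (0 - u) + K (0 - u) = 0 := by
    refine tendsto_nhds_unique ?_ (hS.comp hf.tendsto_atTop)
    exact hz.add ((K.continuous.tendsto _).comp hz)
  have hu0 := hinj _ hu h0
  have h3 := hz.norm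
  rw [hu0] at h3
  simp [hz1] at h3

theorem aux_fredholm_end {Y : Type*} [NormedAddCommGroup Y] [NormedSpace ℂ Y] [CompleteSpace Y]
    (K : Y →L[ℂ] Y) (hK : IsCompactOperator K)
    (hd : DenseRange (fun y => y + K y)) : Function.Bijective (fun y => y + K y) := by
  -- a general consequence of the Fredholm alternative
  have key : ∀ K : Y →L[ℂ] Y, IsCompactOperator K → (∀ y, y + K y = 0 → y = 0) →
      Function.Bijective (fun y => y + K y) := by
    intro K hK hinj
    rcases hK.hasEigenvalue_or_mem_resolventSet (μ := (-1 : ℂ)) (by simp) with h | h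
    · obtain ⟨v, hv⟩ := h.exists_hasEigenvector
      have h1 := hv.apply_eq_smul
      have : v + K v = 0 := by
        have : K v = (-1 : ℂ) • v := h1
        rw [this]; simp
      exact absurd (hinj v this) hv.2
    · rw [spectrum.mem_resolventSet_iff] at h
      have h' := h.neg
      have hb := (ContinuousLinearMap.isUnit_iff_bijective).1 h'
      convert hb using 1
      ext y
      simp
      abel
  let S : Y →L[ℂ] Y := ContinuousLinearMap.id ℂ Y + K
  have hSa : ∀ y, S y = y + K y := fun y => rfl
  let N := LinearMap.ker (S : Y →ₗ[ℂ] Y)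
  have hNc : IsClosed (N : Set Y) := S.isClosed_ker
  have hN : ∀ y, y ∈ N ↔ y + K y = 0 := fun y => Iff.rfl
  have hfin : FiniteDimensional ℂ N := by
    apply FiniteDimensional.of_isCompactOperator_id (𝕜 := ℂ)
    have h1 : IsCompactOperator (K ∘ (N.subtypeL)) := hK.comp_clm _
    have h2 : ∀ x : N, (K ∘ N.subtypeL) x ∈ N := by
      intro x
      have := (hN _).1 x.2
      have h3 : K x = - (x : Y) := by
        rw [eq_neg_iff_add_eq_zero, add_comm]; exact this
      change K x ∈ N
      rw [h3]; exact N.neg_mem x.2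
    have h3 := (h1.codRestrict h2 hNc).neg
    have h5 : (id : N → N) = -(Set.codRestrict (K ∘ N.subtypeL) N h2) := by
      funext x
      have := (hN _).1 x.2
      have h4 : K x = - (x : Y) := by
        rw [eq_neg_iff_add_eq_zero, add_comm]; exact this
      apply Subtype.ext
      change (x : Y) = -(K x)
      rw [h4, neg_neg]
    rw [h5]
    exact h3
  obtain ⟨Z, hZ⟩ := (Submodule.ClosedComplemented.of_finiteDimensional N).exists_isTopCompl
  have hZc : IsClosed (Z : Set Y) := hZ.symm.isClosed
  have hinjZ : ∀ z ∈ Z, z + K z = 0 → z = 0 := by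
    intro z hz h0
    exact Submodule.disjoint_def.1 hZ.isCompl.disjoint z ((hN z).2 h0) hz
  obtain ⟨c, hc, hcb⟩ := aux_bdd_below K hK Z hZc hinjZ
  let R : Z →L[ℂ] Y := S.comp Z.subtypeL
  have hRa : ∀ z : Z, R z = (z : Y) + K z := fun z => rfl
  have hRinj : Function.Injective R := by
    rw [injective_iff_map_eq_zero]
    intro z hz
    exact Subtype.ext (hinjZ z z.2 hz)
  have hanti : AntilipschitzWith (⟨c⁻¹, by positivity⟩) R := by
    refine AddMonoidHomClass.antilipschitz_of_bound R (fun z => ?_)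
    change ‖z‖ ≤ c⁻¹ * ‖R z‖
    rw [← div_eq_inv_mul, le_div_iff₀ hc, mul_comm]
    exact hcb z z.2
  have : CompleteSpace Z := hZc.completeSpace_coe
  have hcl : IsClosed (Set.range R) := hanti.isClosed_range R.uniformContinuous
  have hRrange : Set.range R = Set.range (fun y => y + K y) := by
    apply Set.Subset.antisymm
    · rintro _ ⟨z, rfl⟩; exact ⟨z, rfl⟩
    · rintro _ ⟨y, rfl⟩
      have : y ∈ N ⊔ Z := by rw [hZ.isCompl.sup_eq_top]; trivial
      obtain ⟨n, hn, z, hz, rfl⟩ := Submodule.mem_sup.1 this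
      refine ⟨⟨z, hz⟩, ?_⟩
      rw [hRa]
      have := (hN n).1 hn
      simp only [map_add]
      calc z + K z = (n + K n) + (z + K z) := by rw [this]; simp
        _ = _ := by abel
  have hRsurj : Function.Surjective R := by
    rw [← Set.range_eq_univ, ← hcl.closure_eq, hRrange]
    exact hd.closure_range
  let e : Z ≃L[ℂ] Y := ContinuousLinearEquiv.ofBijective R
    (LinearMap.ker_eq_bot.2 hRinj) (LinearMap.range_eq_top.2 hRsurj)
  have he : ∀ z, e z = (z : Y) + K z := fun z => rfl
  let G : Y →L[ℂ] Y := Z.subtypeL.comp e.symm.toContinuousLinearMap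
  have hG : ∀ y, G y + K (G y) = y := by
    intro y
    have := he (e.symm y)
    rw [e.apply_symm_apply] at this
    exact this.symm
  have hKG : IsCompactOperator (-(K.comp G)) := (hK.comp_clm G).neg
  have hb := key (-(K.comp G)) hKG (by
    intro y hy
    have h1 : G y = y + (-(K.comp G)) y := by
      simp only [neg_apply, ContinuousLinearMap.comp_apply,
        ← sub_eq_add_neg]
      rw [eq_sub_iff_add_eq]
      exact hG y
    rw [hy] at h1
    have := hG y
    rw [h1] at this
    simpa using this.symm)
  have hZtop : ∀ y, y ∈ Z := by
    intro y
    obtain ⟨x, hx⟩ := hb.2 y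
    have h1 : G x = y := by
      rw [← hx]
      simp only [neg_apply, ContinuousLinearMap.comp_apply,
        ← sub_eq_add_neg]
      rw [eq_sub_iff_add_eq]
      exact hG x
    rw [← h1]
    exact (e.symm x).2
  exact key K hK fun y hy => hinjZ y (hZtop y) hy

theorem aux_fredholm {Y Z : Type*} [NormedAddCommGroup Y] [NormedSpace ℂ Y] [CompleteSpace Y]
    [NormedAddCommGroup Z] [NormedSpace ℂ Z] [CompleteSpace Z]
    (M κ : Y →L[ℂ] Z) (hM : Function.Bijective M) (hκ : IsCompactOperator κ)
    (hd : DenseRange (fun y => M y + κ y)) : Function.Bijective (fun y => M y + κ y) := by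
  let e : Y ≃L[ℂ] Z := ContinuousLinearEquiv.ofBijective M
    (LinearMap.ker_eq_bot.2 hM.1) (LinearMap.range_eq_top.2 hM.2)
  have he : ∀ y, e y = M y := fun y => rfl
  let K : Y →L[ℂ] Y := e.symm.toContinuousLinearMap.comp κ
  have hK : IsCompactOperator K :=
    hκ.clm_comp e.symm.toContinuousLinearMap
  have hcomp : (fun y => y + K y) = e.symm ∘ (fun y => M y + κ y) := by
    ext y
    simp [K, ← he]
  have h2 : (fun y => M y + κ y) = e ∘ (fun y => y + K y) := by
    rw [hcomp]; ext y; simp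
  rw [h2]
  refine e.bijective.comp (aux_fredholm_end K hK ?_)
  rw [hcomp]
  exact e.symm.surjective.denseRange.comp hd e.symm.continuous

end P1

section P2
open Filter Topology MeasureTheory

/-- the d-bar operator -/
noncomputable def auxDbar (u : ℂ → ℂ) (a : ℂ) : ℂ :=
  (1 / 2 : ℂ) * (fderiv ℝ u a 1 + Complex.I * fderiv ℝ u a Complex.I)

theorem aux_polar_alg (L : ℂ →L[ℝ] ℂ) (t : ℝ) :
    (L 1 + Complex.I * L Complex.I) * (Complex.exp (t * Complex.I))⁻¹ =
      L (Complex.exp (t * Complex.I)) +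
      Complex.I * L (Complex.I * Complex.exp (t * Complex.I)) := by
  have e : Complex.exp (t * Complex.I) = (Real.cos t : ℂ) + (Real.sin t : ℂ) * Complex.I := by
    rw [Complex.exp_mul_I]; simp
  have e' : (Complex.exp (t * Complex.I))⁻¹ = (Real.cos t : ℂ) - (Real.sin t : ℂ) * Complex.I := by
    rw [← Complex.exp_neg, ← neg_mul, Complex.exp_mul_I]; simp; ring
  have h1 : L (Complex.exp (t * Complex.I)) =
      (Real.cos t : ℂ) * L 1 + (Real.sin t : ℂ) * L Complex.I := by
    rw [e, show (Real.cos t : ℂ) + (Real.sin t : ℂ) * Complex.I =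
      Real.cos t • (1 : ℂ) + Real.sin t • Complex.I by simp, map_add, map_smul, map_smul]
    simp
  have h2 : L (Complex.I * Complex.exp (t * Complex.I)) =
      (Real.cos t : ℂ) * L Complex.I - (Real.sin t : ℂ) * L 1 := by
    rw [e, show Complex.I * ((Real.cos t : ℂ) + (Real.sin t : ℂ) * Complex.I) =
      Real.cos t • Complex.I - Real.sin t • (1 : ℂ) by
        simp only [Complex.real_smul]
        linear_combination (Real.sin t : ℂ) * Complex.I_mul_I, map_sub, map_smul, map_smul]
    simp
  rw [h1, h2, e']
  linear_combination (-(Real.sin t : ℂ) * L Complex.I) * Complex.I_mul_I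

theorem aux_pompeiu_zero (v : ℂ → ℂ) (hv : ContDiff ℝ 1 v) (hc : HasCompactSupport v) :
    ∫ a : ℂ, auxDbar v a * a⁻¹ = -(Real.pi : ℂ) * v 0 := by
  have hfd : Continuous (fderiv ℝ v) := hv.continuous_fderiv one_ne_zero
  obtain ⟨R, hR⟩ : ∃ R : ℝ, ∀ z : ℂ, R < ‖z‖ → v z = 0 ∧ fderiv ℝ v z = 0 := by
    obtain ⟨R, hR⟩ := hc.isCompact.isBounded.subset_closedBall 0
    refine ⟨R, fun z hz => ?_⟩
    have hz' : z ∉ tsupport v := fun h => by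
      have := hR h
      simp at this; linarith
    exact ⟨image_eq_zero_of_notMem_tsupport hz',
      image_eq_zero_of_notMem_tsupport (fun h => hz' (tsupport_fderiv_subset ℝ h))⟩
  set e : ℝ → ℂ := fun t => Complex.exp (t * Complex.I) with he
  have hec : Continuous e := by fun_prop
  have hen : ∀ t, ‖e t‖ = 1 := fun t => Complex.norm_exp_ofReal_mul_I t
  set G1 : ℝ × ℝ → ℂ := fun p => fderiv ℝ v (p.1 * e p.2) (e p.2) with hG1
  set G2 : ℝ × ℝ → ℂ := fun p => fderiv ℝ v (p.1 * e p.2) (Complex.I * e p.2) with hG2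
  have hG1c : Continuous G1 := by
    have : Continuous fun p : ℝ × ℝ => fderiv ℝ v (p.1 * e p.2) := hfd.comp (by fun_prop)
    exact this.clm_apply (by fun_prop)
  have hG2c : Continuous G2 := by
    have : Continuous fun p : ℝ × ℝ => fderiv ℝ v (p.1 * e p.2) := hfd.comp (by fun_prop)
    exact this.clm_apply (by fun_prop)
  have hz : ∀ p : ℝ × ℝ, R < p.1 → fderiv ℝ v (p.1 * e p.2) = 0 := by
    intro p hp
    refine (hR _ ?_).2
    rw [norm_mul, hen, mul_one, Complex.norm_real]
    exact hp.trans_le (le_abs_self _)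
  have hintg : ∀ G : ℝ × ℝ → ℂ, Continuous G → (∀ p : ℝ × ℝ, R < p.1 → G p = 0) →
      IntegrableOn G (Set.Ioi (0:ℝ) ×ˢ Set.Ioo (-Real.pi) Real.pi) (volume.prod volume) := by
    intro G hG hG0
    have h1 : IntegrableOn G (Set.Icc (0:ℝ) R ×ˢ Set.Icc (-Real.pi) Real.pi)
        (volume.prod volume) :=
      hG.continuousOn.integrableOn_compact (isCompact_Icc.prod isCompact_Icc)
    refine h1.of_forall_sdiff_eq_zero (measurableSet_Ioi.prod measurableSet_Ioo) ?_
    rintro ⟨r, t⟩ ⟨⟨hr, ht⟩, hn⟩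
    apply hG0
    by_contra! hle
    exact hn ⟨⟨le_of_lt hr, hle⟩, ⟨ht.1.le, ht.2.le⟩⟩
  have hi1 := hintg G1 hG1c (fun p hp => by simp [hG1, hz p hp])
  have hi2 := hintg G2 hG2c (fun p hp => by simp [hG2, hz p hp])
  have hI1 : ∫ p in Set.Ioi (0:ℝ) ×ˢ Set.Ioo (-Real.pi) Real.pi, G1 p ∂(volume.prod volume) =
      -(2 * Real.pi : ℂ) * v 0 := by
    rw [← setIntegral_prod_swap, setIntegral_prod (fun z : ℝ × ℝ => G1 z.swap) hi1.swap]
    have : ∀ t : ℝ, ∫ r in Set.Ioi (0:ℝ), G1 (r, t) = - v 0 := by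
      intro t
      have hd : ∀ r ∈ Set.Ici (0:ℝ), HasDerivAt (fun r : ℝ => v (r * e t)) (G1 (r, t)) r := by
        intro r _
        have h1 : HasDerivAt (fun r : ℝ => (r : ℂ) * e t) (e t) r := by
          simpa using (Complex.ofRealCLM.hasDerivAt (x := r)).mul_const (e t)
        have h2 := ((hv.differentiable one_ne_zero) (r * e t)).hasFDerivAt
        exact h2.comp_hasDerivAt r h1
      have h3 : IntegrableOn (fun r => G1 (r, t)) (Set.Ioi (0:ℝ)) := by
        have h1 : IntegrableOn (fun r => G1 (r, t)) (Set.Icc (0:ℝ) R) :=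
          (hG1c.comp (by fun_prop)).continuousOn.integrableOn_compact isCompact_Icc
        refine h1.of_forall_sdiff_eq_zero measurableSet_Ioi ?_
        rintro r ⟨hr, hn⟩
        have : R < r := by
          by_contra! hle
          exact hn ⟨le_of_lt hr, hle⟩
        simp [hG1, hz (r, t) this]
      have h4 : Tendsto (fun r : ℝ => v (r * e t)) atTop (𝓝 0) := by
        refine tendsto_const_nhds.congr' ?_
        filter_upwards [eventually_gt_atTop R] with r hr
        refine ((hR _ ?_).1).symm
        rw [norm_mul, hen, mul_one, Complex.norm_real]
        exact hr.trans_le (le_abs_self _)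
      rw [integral_Ioi_of_hasDerivAt_of_tendsto' hd h3 h4]
      simp
    simp only [Prod.swap_prod_mk, this]
    rw [setIntegral_const]
    have hpi := Real.pi_pos
    rw [Measure.real, Real.volume_Ioo, ENNReal.toReal_ofReal (by linarith), Complex.real_smul]
    push_cast; ring
  have hI2 : ∫ p in Set.Ioi (0:ℝ) ×ˢ Set.Ioo (-Real.pi) Real.pi, G2 p ∂(volume.prod volume) = 0 := by
    rw [setIntegral_prod _ hi2]
    have : ∀ r ∈ Set.Ioi (0:ℝ), ∫ t in Set.Ioo (-Real.pi) Real.pi, G2 (r, t) = 0 := by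
      intro r hr
      have hr0 : (r : ℂ) ≠ 0 := by exact_mod_cast (ne_of_gt hr)
      rw [← integral_Ioc_eq_integral_Ioo,
        ← intervalIntegral.integral_of_le (by linarith [Real.pi_pos])]
      have hd : ∀ t : ℝ, HasDerivAt (fun t : ℝ => (r:ℂ)⁻¹ * v (r * e t)) (G2 (r, t)) t := by
        intro t
        have h1 : HasDerivAt (fun t : ℝ => (r : ℂ) * e t) (r * (Complex.I * e t)) t := by
          have : HasDerivAt e (Complex.I * e t) t := by
            have h0 : HasDerivAt (fun t : ℝ => (t : ℂ) * Complex.I) Complex.I t := by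
              simpa using (Complex.ofRealCLM.hasDerivAt (x := t)).mul_const Complex.I
            exact h0.cexp.congr_deriv (mul_comm _ _)
          exact this.const_mul _
        have h2 := ((hv.differentiable one_ne_zero) (r * e t)).hasFDerivAt
        have h3 := (h2.comp_hasDerivAt t h1).const_mul (r:ℂ)⁻¹
        refine h3.congr_deriv ?_
        rw [← Complex.real_smul (z := Complex.I * e t), map_smul, Complex.real_smul,
          inv_mul_cancel_left₀ hr0]
      rw [intervalIntegral.integral_eq_sub_of_hasDerivAt (fun t _ => hd t)
        ((hG2c.comp (by fun_prop : Continuous fun t : ℝ => (r, t))).intervalIntegrable _ _)]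
      have : e Real.pi = e (-Real.pi) := by
        simp only [he]
        rw [Complex.exp_pi_mul_I]; push_cast; rw [neg_mul, Complex.exp_neg, Complex.exp_pi_mul_I]
        norm_num
      rw [this, sub_self]
    rw [setIntegral_congr_fun measurableSet_Ioi this]
    simp
  rw [← Complex.integral_comp_polarCoord_symm]
  have hcongr : ∀ p ∈ Set.Ioi (0:ℝ) ×ˢ Set.Ioo (-Real.pi) Real.pi,
      p.1 • (auxDbar v (Complex.polarCoord.symm p) * (Complex.polarCoord.symm p)⁻¹) =
      (1/2 : ℂ) * G1 p + (1/2 * Complex.I) * G2 p := by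
    rintro ⟨r, t⟩ ⟨hr, _⟩
    have hr0 : (r : ℂ) ≠ 0 := by exact_mod_cast (ne_of_gt hr)
    have hs : Complex.polarCoord.symm (r, t) = r * e t := by
      rw [Complex.polarCoord_symm_apply, he]
      simp [Complex.exp_mul_I]
    rw [hs]
    have := aux_polar_alg (fderiv ℝ v (r * e t)) t
    change (_ : ℂ) * (e t)⁻¹ = fderiv ℝ v (r * e t) (e t) +
      Complex.I * fderiv ℝ v (r * e t) (Complex.I * e t) at this
    simp only [auxDbar, hG1, hG2, Complex.real_smul, mul_inv]
    have h2 : (r : ℂ) * (r : ℂ)⁻¹ = 1 := mul_inv_cancel₀ hr0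
    linear_combination (1/2 : ℂ) * this + (1 / 2 : ℂ) * (fderiv ℝ v (r * e t) 1 +
      Complex.I * fderiv ℝ v (r * e t) Complex.I) * (e t)⁻¹ * h2
  change ∫ p in Set.Ioi (0:ℝ) ×ˢ Set.Ioo (-Real.pi) Real.pi, _ ∂(volume.prod volume) = _
  rw [setIntegral_congr_fun (measurableSet_Ioi.prod measurableSet_Ioo) hcongr,
    integral_add (hi1.const_mul _) (hi2.const_mul _), integral_const_mul, integral_const_mul,
    hI1, hI2]
  ring

theorem aux_pompeiu (u : ℂ → ℂ) (hu : ContDiff ℝ 1 u) (hc : HasCompactSupport u) (x : ℂ) :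
    ∫ a : ℂ, auxDbar u a * (a - x)⁻¹ = -(Real.pi : ℂ) * u x := by
  have h := aux_pompeiu_zero (fun z => u (z + x)) (hu.comp (contDiff_id.add contDiff_const))
    (hc.comp_homeomorph (Homeomorph.addRight x))
  rw [← integral_sub_right_eq_self _ x] at h
  simp only [zero_add] at h
  rw [← h]
  congr 1
  ext a
  have : auxDbar (fun z => u (z + x)) (a - x) = auxDbar u a := by
    simp only [auxDbar, fderiv_comp_add_right, sub_add_cancel]
  rw [this]

end P2

section P3
open Filter Topology MeasureTheory

theorem aux_circle_nolog (a : ℂ) (R : ℝ) (hR : 0 < R) (h : ℂ → ℂ) (hc : Continuous h)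
    (hh : ∀ x, ‖x - a‖ = R → Complex.exp (h x) = x - a) : False := by
  set k : ℝ → ℝ := fun t => (h (a + R * Complex.exp (t * Complex.I)) - t * Complex.I).im with hk
  have hkc : Continuous k := by
    apply Complex.continuous_im.comp
    exact (hc.comp (by fun_prop)).sub (by fun_prop)
  have hintg : ∀ t, ∃ n : ℤ, k t = n * (2 * Real.pi) := by
    intro t
    have h1 : Complex.exp (h (a + R * Complex.exp (t * Complex.I)) - t * Complex.I) =
        Complex.exp (Real.log R) := by
      rw [Complex.exp_sub, hh _ (by simp [Complex.norm_exp_ofReal_mul_I, abs_of_pos hR])]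
      rw [← Complex.ofReal_exp, Real.exp_log hR]
      field_simp
      ring
    obtain ⟨n, hn⟩ := Complex.exp_eq_exp_iff_exists_int.1 h1
    refine ⟨n, ?_⟩
    simp only [hk, hn]
    simp [Complex.add_im, Complex.mul_im]
  have h2 : k (2 * Real.pi) = k 0 - 2 * Real.pi := by
    simp only [hk]
    have : Complex.exp (((2 * Real.pi : ℝ) : ℂ) * Complex.I) = 1 := by
      push_cast; exact Complex.exp_two_pi_mul_I
    rw [this]
    simp
  have hpi := Real.pi_pos
  have h3 : k 0 - Real.pi ∈ Set.Icc (k (2 * Real.pi)) (k 0) := by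
    rw [h2]; constructor <;> linarith
  obtain ⟨t, -, ht⟩ := intermediate_value_Icc' (by linarith : (0:ℝ) ≤ 2 * Real.pi)
    hkc.continuousOn h3
  obtain ⟨n, hn⟩ := hintg t
  obtain ⟨m, hm⟩ := hintg 0
  rw [hn, hm] at ht
  have h5 : (n : ℝ) * 2 = m * 2 - 1 := by
    have := hpi.ne'
    apply mul_right_cancel₀ this
    linarith
  have h6 : n * 2 = m * 2 - 1 := by exact_mod_cast h5
  omega

theorem aux_unbounded_component (D K : Set ℂ) (hDo : IsOpen D) (hsc : IsSimplyConnected D)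
    (hK : IsCompact K) (hKD : K ⊆ D) (a : ℂ) (ha : a ∉ D) :
    ¬ Bornology.IsBounded (connectedComponentIn Kᶜ a) := by
  intro hb
  set V := connectedComponentIn Kᶜ a with hV
  have haK : a ∈ Kᶜ := fun h => ha (hKD h)
  have haV : a ∈ V := mem_connectedComponentIn haK
  have hKo : IsOpen Kᶜ := hK.isClosed.isOpen_compl
  have hVo : IsOpen V := hKo.connectedComponentIn
  have hfr : frontier V ⊆ K := by
    intro x hx
    by_contra hxK
    have hxW : x ∈ connectedComponentIn Kᶜ x := mem_connectedComponentIn hxK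
    have hWo : IsOpen (connectedComponentIn Kᶜ x) := hKo.connectedComponentIn
    obtain ⟨z, hzW, hzV⟩ := mem_closure_iff.1 hx.1 _ hWo hxW
    have : connectedComponentIn Kᶜ x = V := by
      rw [connectedComponentIn_eq hzW, hV, connectedComponentIn_eq hzV]
    rw [this] at hxW
    exact hx.2 (by rwa [hVo.interior_eq])
  obtain ⟨g, hgc, hge⟩ := Complex.exists_continuousOn_eqOn_exp_comp hsc hDo
    (g := fun x => x - a) (by fun_prop) (by
      rintro ⟨x, hx, hxa⟩
      have : x = a := sub_eq_zero.1 hxa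
      exact ha (this ▸ hx))
  obtain ⟨G, hG⟩ := ContinuousMap.exists_restrict_eq (Y := ℂ) hK.isClosed
    ⟨K.domRestrict g, continuousOn_iff_continuous_domRestrict.1 (hgc.mono hKD)⟩
  have hGK : ∀ x ∈ K, Complex.exp (G x) = x - a := by
    intro x hx
    have h1 : G x = g x := congrArg (fun f => f ⟨x, hx⟩) hG
    rw [h1]
    exact hge (hKD hx)
  classical
  set F : ℂ → ℂ := fun x => if x ∈ V then Complex.exp (G x) else x - a with hF
  have hFc : Continuous F := by
    apply Continuous.if
    · intro x hx
      exact hGK x (hfr hx)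
    · exact Complex.continuous_exp.comp G.continuous
    · fun_prop
  have hF0 : ∀ x, F x ≠ 0 := by
    intro x
    simp only [hF]
    split_ifs with h
    · exact Complex.exp_ne_zero _
    · intro h0
      exact h ((sub_eq_zero.1 h0) ▸ haV)
  have huniv : IsSimplyConnected (Set.univ : Set ℂ) := by
    have : ContractibleSpace (Set.univ : Set ℂ) :=
      (convex_univ (𝕜 := ℝ)).contractibleSpace Set.univ_nonempty
    exact (inferInstance : SimplyConnectedSpace (Set.univ : Set ℂ))
  obtain ⟨h, hhc, hhe⟩ := Complex.exists_continuousOn_eqOn_exp_comp huniv isOpen_univ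
    hFc.continuousOn (by rintro ⟨x, -, hx⟩; exact hF0 x hx)
  obtain ⟨R, hR⟩ := hb.subset_closedBall a
  refine aux_circle_nolog a (max R 0 + 1) (by positivity) h (continuousOn_univ.1 hhc) ?_
  intro x hx
  have hxV : x ∉ V := fun hxV => by
    have := hR hxV
    rw [Metric.mem_closedBall, dist_eq_norm, hx] at this
    linarith [le_max_left R 0]
  have := hhe (Set.mem_univ x)
  simpa [hF, hxV] using this

end P3

section P3b
open Filter Topology MeasureTheory

theorem aux_dbar_holo (u : ℂ → ℂ) (a : ℂ) (h : DifferentiableAt ℂ u a) : auxDbar u a = 0 := by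
  have h1 := h.hasFDerivAt.restrictScalars ℝ
  rw [auxDbar, h1.fderiv]
  have : fderiv ℂ u a Complex.I = Complex.I * fderiv ℂ u a 1 := by
    rw [← smul_eq_mul, ← map_smul]; simp
  simp only [ContinuousLinearMap.coe_restrictScalars']
  rw [this]
  linear_combination (1/2 : ℂ) * fderiv ℂ u a 1 * Complex.I_mul_I

/-- closure of polynomials -/
noncomputable def auxA (K : Set ℂ) [CompactSpace K] : Subalgebra ℂ C(K, ℂ) :=
  (polynomialFunctions K).topologicalClosure

theorem aux_runge_mem (D K : Set ℂ) (hDo : IsOpen D) (hsc : IsSimplyConnected D)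
    [hKc : CompactSpace K] (hKD : K ⊆ D) (g : ℂ → ℂ) (hg : DifferentiableOn ℂ g D)
    (f : C(K, ℂ)) (hf : ∀ x : K, f x = g x) : f ∈ auxA K := by
  have hK : IsCompact K := isCompact_iff_compactSpace.2 hKc
  have hcl : IsClosed ((auxA K : Subalgebra ℂ C(K, ℂ)) : Set C(K, ℂ)) :=
    Subalgebra.isClosed_topologicalClosure (polynomialFunctions K)
  have : CompleteSpace (auxA K) := hcl.completeSpace_coe
  set X : auxA K := ⟨Polynomial.toContinuousMapOnAlgHom K Polynomial.X,
    (polynomialFunctions K).le_topologicalClosure ⟨Polynomial.X, trivial, rfl⟩⟩ with hX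
  have hXv : ∀ x : K, (X : C(K, ℂ)) x = x := by
    intro x; simp [hX]
  set σ := spectrum ℂ X with hσ
  have hσK : spectrum ℂ (X : C(K, ℂ)) = K := by
    rw [ContinuousMap.spectrum_eq_range]
    ext z; constructor
    · rintro ⟨x, rfl⟩; rw [hXv]; exact x.2
    · intro hz; exact ⟨⟨z, hz⟩, hXv _⟩
  have hKσ : K ⊆ σ := by
    rw [← hσK]; exact spectrum.subset_subalgebra X
  have hσD : σ ⊆ D := by
    intro a ha
    by_contra haD
    have hcl' := hcl
    have h1 := Subalgebra.spectrum_isBounded_connectedComponentIn (hS := hcl) (auxA K) X ha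
    rw [hσK] at h1
    exact aux_unbounded_component D K hDo hsc hK hKD a haD h1
  have hσc : IsCompact σ := spectrum.isCompact X
  obtain ⟨t, htc, hσt, htD⟩ := exists_compact_between hσc hDo hσD
  obtain ⟨χ, hχ1, hχ0, -⟩ := exists_contMDiffMap_one_nhds_of_subset_interior (n := 1)
    (modelWithCornersSelf ℝ ℂ) hσc.isClosed hσt
  have hχd : ContDiff ℝ 1 χ := χ.contMDiff.contDiff
  set u : ℂ → ℂ := fun z => (χ z : ℂ) * g z with hu
  have hu0 : ∀ z ∉ t, u z = 0 := fun z hz => by simp [hu, hχ0 z hz]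
  have hud : ContDiff ℝ 1 u := by
    rw [contDiff_iff_contDiffAt]
    intro z
    by_cases hz : z ∈ D
    · have h1 : ContDiffAt ℂ 1 g z := (hg.analyticAt (hDo.mem_nhds hz)).contDiffAt
      exact (Complex.ofRealCLM.contDiff.comp hχd).contDiffAt.mul (h1.restrict_scalars ℝ)
    · have : u =ᶠ[𝓝 z] fun _ => 0 := by
        filter_upwards [htc.isClosed.isOpen_compl.mem_nhds (fun h => hz (htD h))] with w hw
        exact hu0 w hw
      exact contDiffAt_const.congr_of_eventuallyEq this
  have hus : HasCompactSupport u := HasCompactSupport.intro htc (fun z hz => hu0 z hz)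
  have hdb : ∀ᶠ z in 𝓝ˢ σ, auxDbar u z = 0 := by
    have h1 : ∀ᶠ z in 𝓝ˢ σ, ∀ᶠ w in 𝓝 z, χ w = 1 := hχ1.eventually_nhdsSet
    have h2 : ∀ᶠ z in 𝓝ˢ σ, z ∈ D := hDo.mem_nhdsSet.2 hσD
    filter_upwards [h1, h2] with z hz hzD
    apply aux_dbar_holo
    have h3 : u =ᶠ[𝓝 z] g := by
      filter_upwards [hz] with w hw
      simp [hu, hw]
    exact ((hg z hzD).differentiableAt (hDo.mem_nhds hzD)).congr_of_eventuallyEq h3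
  have hdbc : Continuous (auxDbar u) := by
    have h1 : Continuous (fderiv ℝ u) := hud.continuous_fderiv one_ne_zero
    unfold auxDbar
    exact continuous_const.mul ((h1.clm_apply continuous_const).add
      (continuous_const.mul (h1.clm_apply continuous_const)))
  set Φ : ℂ → auxA K := fun a => auxDbar u a • resolvent X a with hΦ
  have hΦc : Continuous Φ := by
    rw [continuous_iff_continuousAt]
    intro a
    by_cases ha : a ∈ σ
    · have h1 : Φ =ᶠ[𝓝 a] fun _ => 0 := by
        filter_upwards [hdb.filter_mono (nhds_le_nhdsSet ha)] with z hz
        simp [hΦ, hz]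
      exact continuousAt_const.congr h1.symm
    · have h1 : a ∈ resolventSet ℂ X := by simpa [hσ, spectrum] using ha
      exact hdbc.continuousAt.smul (spectrum.hasDerivAt_resolvent_const_left h1).continuousAt
  have hΦs : HasCompactSupport Φ := by
    refine HasCompactSupport.intro htc (fun z hz => ?_)
    have : auxDbar u z = 0 := by
      apply aux_dbar_holo
      have : u =ᶠ[𝓝 z] fun _ => 0 := by
        filter_upwards [htc.isClosed.isOpen_compl.mem_nhds hz] with w hw
        exact hu0 w hw
      exact (differentiableAt_const 0).congr_of_eventuallyEq this
    simp [hΦ, this]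
  have hΦi : Integrable Φ := hΦc.integrable_of_hasCompactSupport hΦs
  have key : ∀ x : K, ((∫ a, Φ a : auxA K) : C(K, ℂ)) x = -(Real.pi : ℂ) * g x := by
    intro x
    set ev : auxA K →L[ℂ] ℂ := (ContinuousMap.evalCLM ℂ x).comp
      (Subalgebra.toSubmodule (auxA K)).subtypeL with hev
    have h0 : ∀ f : auxA K, ev f = (f : C(K, ℂ)) x := fun f => rfl
    rw [← h0, ← ContinuousLinearMap.integral_comp_comm _ hΦi]
    have hux : u x = g x := by
      have : χ x = 1 := hχ1.self_of_nhdsSet _ (hKσ x.2)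
      simp [hu, this]
    rw [← hux, ← aux_pompeiu u hud hus x]
    congr 1
    ext a
    by_cases ha : a ∈ σ
    · have := hdb.self_of_nhdsSet a ha
      simp [hΦ, this]
    · have h1 : a ∈ resolventSet ℂ X := by simpa [hσ, spectrum] using ha
      simp only [hΦ, map_smul, smul_eq_mul]
      congr 1
      have h2 : resolvent X a * (algebraMap ℂ (auxA K) a - X) = 1 :=
        Ring.inverse_mul_cancel _ h1
      have h3 := congrArg (fun f : auxA K => (f : C(K, ℂ)) x) h2
      have h4 : ((resolvent X a : auxA K) : C(K, ℂ)) x * (a - x) = 1 := by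
        simpa [hXv] using h3
      rw [h0]
      exact eq_inv_of_mul_eq_one_left h4
  have hfin : f = (-(Real.pi : ℂ)⁻¹) • ((∫ a, Φ a : auxA K) : C(K, ℂ)) := by
    ext x
    have hpi : (Real.pi : ℂ) ≠ 0 := by exact_mod_cast Real.pi_ne_zero
    rw [ContinuousMap.smul_apply, key, hf, smul_eq_mul]
    field_simp
  rw [hfin]
  exact Subalgebra.smul_mem _ (∫ a, Φ a : auxA K).2 _

end P3b

section P4a
open Filter Topology MeasureTheory

structure AuxNice (c : ℂ) (K : Set ℂ) : Prop where
  compact : IsCompact K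
  mem : c ∈ K
  bound : ∃ C : ℝ, 0 ≤ C ∧ ∀ (f f' : ℂ → ℂ) (M : ℝ), (∀ x ∈ K, HasDerivAt f (f' x) x) →
    (∀ x ∈ K, ‖f' x‖ ≤ M) → ∀ x ∈ K, ‖f x - f c‖ ≤ C * M
  lip : ∀ x ∈ K, ∃ δ : ℝ, 0 < δ ∧ ∀ (f f' : ℂ → ℂ) (M : ℝ),
    (∀ x ∈ K, HasDerivAt f (f' x) x) → (∀ x ∈ K, ‖f' x‖ ≤ M) →
      ∀ x' ∈ K, dist x' x < δ → ‖f x' - f x‖ ≤ M * dist x' x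

theorem AuxNice.ball (c : ℂ) (r : ℝ) (hr : 0 < r) : AuxNice c (Metric.closedBall c r) := by
  have key : ∀ (f f' : ℂ → ℂ) (M : ℝ), (∀ x ∈ Metric.closedBall c r, HasDerivAt f (f' x) x) →
    (∀ x ∈ Metric.closedBall c r, ‖f' x‖ ≤ M) → ∀ x ∈ Metric.closedBall c r,
      ∀ y ∈ Metric.closedBall c r, ‖f y - f x‖ ≤ M * ‖y - x‖ := by
    intro f f' M h1 h2 x hx y hy
    exact (convex_closedBall c r).norm_image_sub_le_of_norm_hasDerivWithin_le
      (fun x hx => (h1 x hx).hasDerivWithinAt) h2 hx hy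
  have hc : c ∈ Metric.closedBall c r := Metric.mem_closedBall_self hr.le
  refine ⟨isCompact_closedBall c r, hc, ⟨r, hr.le, ?_⟩, ?_⟩
  · intro f f' M h1 h2 x hx
    have h0 : 0 ≤ M := (norm_nonneg _).trans (h2 c hc)
    have h3 := key f f' M h1 h2 c hc x hx
    have h4 : ‖x - c‖ ≤ r := by simpa [dist_eq_norm] using hx
    calc _ ≤ _ := h3
      _ ≤ M * r := by gcongr
      _ = _ := mul_comm _ _
  · intro x hx
    refine ⟨1, one_pos, fun f f' M h1 h2 x' hx' _ => ?_⟩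
    rw [dist_eq_norm]
    exact key f f' M h1 h2 x hx x' hx'

theorem aux_lip_union (K K' : Set ℂ) (hK' : IsClosed K') (x : ℂ)
    (h : ∃ δ : ℝ, 0 < δ ∧ ∀ (f f' : ℂ → ℂ) (M : ℝ),
    (∀ x ∈ K, HasDerivAt f (f' x) x) → (∀ x ∈ K, ‖f' x‖ ≤ M) →
      ∀ x' ∈ K, dist x' x < δ → ‖f x' - f x‖ ≤ M * dist x' x)
    (h' : x ∈ K' → ∃ δ : ℝ, 0 < δ ∧ ∀ (f f' : ℂ → ℂ) (M : ℝ),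
    (∀ x ∈ K', HasDerivAt f (f' x) x) → (∀ x ∈ K', ‖f' x‖ ≤ M) →
      ∀ x' ∈ K', dist x' x < δ → ‖f x' - f x‖ ≤ M * dist x' x) :
    ∃ δ : ℝ, 0 < δ ∧ ∀ (f f' : ℂ → ℂ) (M : ℝ),
    (∀ x ∈ K ∪ K', HasDerivAt f (f' x) x) → (∀ x ∈ K ∪ K', ‖f' x‖ ≤ M) →
      ∀ x' ∈ K ∪ K', dist x' x < δ → ‖f x' - f x‖ ≤ M * dist x' x := by
  obtain ⟨δ, hδ, h⟩ := h
  by_cases hx : x ∈ K'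
  · obtain ⟨δ', hδ', h'⟩ := h' hx
    refine ⟨min δ δ', lt_min hδ hδ', ?_⟩
    rintro f f' M h1 h2 x' (hx' | hx') hd
    · exact h f f' M (fun x hx => h1 x (Or.inl hx)) (fun x hx => h2 x (Or.inl hx)) x' hx'
        (hd.trans_le (min_le_left _ _))
    · exact h' f f' M (fun x hx => h1 x (Or.inr hx)) (fun x hx => h2 x (Or.inr hx)) x' hx'
        (hd.trans_le (min_le_right _ _))
  · obtain ⟨δ', hδ', hb⟩ := Metric.isOpen_iff.1 hK'.isOpen_compl x hx
    refine ⟨min δ δ', lt_min hδ hδ', ?_⟩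
    rintro f f' M h1 h2 x' (hx' | hx') hd
    · exact h f f' M (fun x hx => h1 x (Or.inl hx)) (fun x hx => h2 x (Or.inl hx)) x' hx'
        (hd.trans_le (min_le_left _ _))
    · exact absurd hx' (hb (hd.trans_le (min_le_right _ _)))

theorem AuxNice.union {c z : ℂ} {K K' : Set ℂ} (h : AuxNice c K) (hz : z ∈ K)
    (h' : AuxNice z K') : AuxNice c (K ∪ K') := by
  refine ⟨h.compact.union h'.compact, Or.inl h.mem, ?_, ?_⟩
  · obtain ⟨C, hC, hb⟩ := h.bound
    obtain ⟨C', hC', hb'⟩ := h'.bound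
    refine ⟨C + C', by positivity, fun f f' M h1 h2 x hx => ?_⟩
    have h0 : 0 ≤ M := (norm_nonneg _).trans (h2 c (Or.inl h.mem))
    have k := hb f f' M (fun x hx => h1 x (Or.inl hx)) (fun x hx => h2 x (Or.inl hx))
    rcases hx with hx | hx
    · refine (k x hx).trans ?_
      nlinarith
    · have k' := hb' f f' M (fun x hx => h1 x (Or.inr hx)) (fun x hx => h2 x (Or.inr hx)) x hx
      calc ‖f x - f c‖ = ‖(f z - f c) + (f x - f z)‖ := by congr 1; ring
        _ ≤ ‖f z - f c‖ + ‖f x - f z‖ := norm_add_le _ _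
        _ ≤ C * M + C' * M := add_le_add (k z hz) k'
        _ = _ := by ring
  · rintro x (hx | hx)
    · exact aux_lip_union K K' h'.compact.isClosed x (h.lip x hx) (h'.lip x)
    · rw [Set.union_comm]
      exact aux_lip_union K' K h.compact.isClosed x (h'.lip x hx) (h.lip x)

theorem aux_nice_exists (D : Set ℂ) (hD : IsOpen D) (hDc : IsPreconnected D) (c : ℂ) (hc : c ∈ D)
    (z : ℂ) (hz : z ∈ D) : ∃ K, AuxNice c K ∧ K ⊆ D ∧ z ∈ interior K := by
  set U : Set ℂ := {z | ∃ K, AuxNice c K ∧ K ⊆ D ∧ z ∈ interior K} with hU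
  have hUo : IsOpen U := by
    rw [isOpen_iff_mem_nhds]
    rintro z ⟨K, h1, h2, h3⟩
    filter_upwards [isOpen_interior.mem_nhds h3] with w hw
    exact ⟨K, h1, h2, hw⟩
  have hcU : c ∈ U := by
    obtain ⟨r, hr, hb⟩ := Metric.nhds_basis_closedBall.mem_iff.1 (hD.mem_nhds hc)
    exact ⟨_, AuxNice.ball c r hr, hb,
      Metric.ball_subset_interior_closedBall (Metric.mem_ball_self hr)⟩
  have := hDc.subset_of_closure_inter_subset hUo ⟨c, hc, hcU⟩ (by
    rintro w ⟨hwU, hwD⟩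
    obtain ⟨r, hr, hb⟩ := Metric.nhds_basis_closedBall.mem_iff.1 (hD.mem_nhds hwD)
    obtain ⟨v, ⟨K, h1, h2, h3⟩, hwv⟩ := Metric.mem_closure_iff.1 hwU (r / 2) (half_pos hr)
    refine ⟨_, h1.union (interior_subset h3) (AuxNice.ball v (r / 2) (half_pos hr)), ?_, ?_⟩
    · refine Set.union_subset h2 (fun x hx => hb ?_)
      rw [Metric.mem_closedBall] at hx ⊢
      have := dist_triangle x v w
      rw [dist_comm] at hwv
      linarith
    · refine interior_mono Set.subset_union_right ?_
      exact Metric.ball_subset_interior_closedBall hwv)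
  exact this hz

theorem aux_nice_finite (D : Set ℂ) (hD : IsOpen D) (hDc : IsPreconnected D) (c : ℂ) (hc : c ∈ D)
    (F : Set ℂ) (hF : F.Finite) (hFD : F ⊆ D) : ∃ K, AuxNice c K ∧ K ⊆ D ∧ F ⊆ interior K := by
  induction F, hF using Set.Finite.induction_on with
  | empty =>
    obtain ⟨K, h1, h2, h3⟩ := aux_nice_exists D hD hDc c hc c hc
    exact ⟨K, h1, h2, Set.empty_subset _⟩
  | insert _ _ ih =>
    obtain ⟨K, h1, h2, h3⟩ := ih ((Set.subset_insert _ _).trans hFD)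
    obtain ⟨K', h1', h2', h3'⟩ := aux_nice_exists D hD hDc c hc _ (hFD (Set.mem_insert _ _))
    refine ⟨K ∪ K', h1.union h1.mem h1', Set.union_subset h2 h2', ?_⟩
    exact Set.insert_subset (interior_mono Set.subset_union_right h3')
      (h3.trans (interior_mono Set.subset_union_left))

end P4a

section P4b
open Filter Topology MeasureTheory

theorem aux_A_closed (K : Set ℂ) [CompactSpace K] : IsClosed ((auxA K : Set C(K, ℂ))) :=
  Subalgebra.isClosed_topologicalClosure (polynomialFunctions K)

noncomputable instance aux_A_complete (K : Set ℂ) [CompactSpace K] : CompleteSpace (auxA K) :=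
  (aux_A_closed K).completeSpace_coe

/-- polynomial as an element of `A(K)` -/
noncomputable def auxP (K : Set ℂ) [CompactSpace K] : Polynomial ℂ →ₐ[ℂ] auxA K :=
  (Polynomial.toContinuousMapOnAlgHom K).codRestrict (auxA K)
    (fun P => (polynomialFunctions K).le_topologicalClosure ⟨P, trivial, rfl⟩)

theorem auxP_apply (K : Set ℂ) [CompactSpace K] (P : Polynomial ℂ) (x : K) :
    ((auxP K P : auxA K) : C(K, ℂ)) x = P.eval (x : ℂ) := by
  rfl

theorem auxP_dense (K : Set ℂ) [CompactSpace K] : DenseRange (auxP K) := by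
  intro w
  rw [closure_subtype]
  have h : (w : C(K, ℂ)) ∈ closure ((polynomialFunctions K : Set C(K, ℂ))) := w.2
  convert h using 2
  ext f
  constructor
  · rintro ⟨_, ⟨P, rfl⟩, rfl⟩
    exact ⟨P, trivial, rfl⟩
  · rintro ⟨P, -, rfl⟩
    exact ⟨_, ⟨P, rfl⟩, rfl⟩

theorem aux_derivative_surj (P : Polynomial ℂ) : ∃ R : Polynomial ℂ, Polynomial.derivative R = P := by
  induction P using Polynomial.induction_on' with
  | add p q hp hq =>
    obtain ⟨a, rfl⟩ := hp
    obtain ⟨b, rfl⟩ := hq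
    exact ⟨a + b, by simp⟩
  | monomial n a =>
    refine ⟨Polynomial.monomial (n + 1) (a / ((n : ℂ) + 1)), ?_⟩
    rw [Polynomial.derivative_monomial]
    have : (n : ℂ) + 1 ≠ 0 := by exact_mod_cast n.succ_ne_zero
    simp [this]

theorem aux_A_norm_le {K : Set ℂ} [CompactSpace K] (w : auxA K) {C : ℝ} (hC : 0 ≤ C) :
    ‖w‖ ≤ C ↔ ∀ x : K, ‖(w : C(K, ℂ)) x‖ ≤ C := by
  rw [← ContinuousMap.norm_le _ hC]; rfl

theorem aux_A_le_norm {K : Set ℂ} [CompactSpace K] (w : auxA K) (x : K) :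
    ‖(w : C(K, ℂ)) x‖ ≤ ‖w‖ := (aux_A_norm_le w (norm_nonneg _)).1 le_rfl x

theorem aux_A_eval_cont {K : Set ℂ} [CompactSpace K] (x : K) :
    Continuous fun w : auxA K => (w : C(K, ℂ)) x :=
  (continuous_eval_const x).comp continuous_subtype_val

/-- The defining property of the integration operator -/
def AuxInt (c : ℂ) (K : Set ℂ) [CompactSpace K] (J : auxA K →L[ℂ] auxA K) : Prop :=
  ∀ P : Polynomial ℂ, J (auxP K (Polynomial.derivative P)) = auxP K (P - Polynomial.C (P.eval c))

theorem aux_J_lip {c : ℂ} {K : Set ℂ} [CompactSpace K] (hK : AuxNice c K)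
    {J : auxA K →L[ℂ] auxA K} (hJ : AuxInt c K J) (x : K) :
    ∃ δ : ℝ, 0 < δ ∧ ∀ x' : K, dist x' x < δ → ∀ w : auxA K,
      ‖(J w : C(K, ℂ)) x' - (J w : C(K, ℂ)) x‖ ≤ ‖w‖ * dist x' x := by
  obtain ⟨δ, hδ, h⟩ := hK.lip x x.2
  refine ⟨δ, hδ, fun x' hx' w => ?_⟩
  have hcl : IsClosed {w : auxA K |
      ‖(J w : C(K, ℂ)) x' - (J w : C(K, ℂ)) x‖ ≤ ‖w‖ * dist x' x} := by
    refine isClosed_le ?_ (by fun_prop)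
    exact (((aux_A_eval_cont x').comp J.continuous).sub
      ((aux_A_eval_cont x).comp J.continuous)).norm
  refine (auxP_dense K).induction_on (p := fun w => w ∈ {w : auxA K |
      ‖(J w : C(K, ℂ)) x' - (J w : C(K, ℂ)) x‖ ≤ ‖w‖ * dist x' x}) w hcl ?_
  intro P
  obtain ⟨R, rfl⟩ := aux_derivative_surj P
  rw [Set.mem_ofPred_eq, hJ R, auxP_apply, auxP_apply]
  have := h (fun z => R.eval z) (fun z => (Polynomial.derivative R).eval z)
    ‖auxP K (Polynomial.derivative R)‖ (fun z _ => R.hasDerivAt z)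
    (fun z hz => by
      have := aux_A_le_norm (auxP K (Polynomial.derivative R)) ⟨z, hz⟩
      rwa [auxP_apply] at this) x' x'.2 hx'
  rw [Polynomial.eval_sub, Polynomial.eval_sub, Polynomial.eval_C, Polynomial.eval_C, sub_sub_sub_cancel_right]
  exact this

theorem aux_J_compact {c : ℂ} {K : Set ℂ} [CompactSpace K] (hK : AuxNice c K)
    {J : auxA K →L[ℂ] auxA K} (hJ : AuxInt c K J) : IsCompactOperator J := by
  set ι : auxA K → BoundedContinuousFunction K ℂ :=
    fun w => ContinuousMap.equivBoundedOfCompact K ℂ (w : C(K, ℂ)) with hι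
  have hiso : Isometry ι :=
    (ContinuousMap.isometryEquivBoundedOfCompact K ℂ).isometry.comp isometry_subtype_coe
  have hce : IsClosedEmbedding ι := hiso.isClosedEmbedding
  have hιv : ∀ w x, ι w x = (w : C(K, ℂ)) x := fun w x => rfl
  set T : Set (BoundedContinuousFunction K ℂ) := ι '' (J '' Metric.closedBall 0 1) with hT
  have hcomp : IsCompact (closure T) := by
    refine BoundedContinuousFunction.arzela_ascoli (Metric.closedBall (0:ℂ) ‖J‖)
      (isCompact_closedBall _ _) T ?_ ?_
    · rintro _ x ⟨_, ⟨w, hw, rfl⟩, rfl⟩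
      rw [mem_closedBall_zero_iff] at hw ⊢
      rw [hιv]
      exact (aux_A_le_norm _ _).trans (J.unit_le_opNorm w hw)
    · intro x
      rw [Metric.equicontinuousAt_iff]
      intro ε hε
      obtain ⟨δ, hδ, h⟩ := aux_J_lip hK hJ x
      refine ⟨min δ ε, lt_min hδ hε, ?_⟩
      rintro x' hx' ⟨_, ⟨_, ⟨w, hw, rfl⟩, rfl⟩⟩
      rw [mem_closedBall_zero_iff] at hw
      have h1 := h x' (hx'.trans_le (min_le_left _ _)) w
      have h2 := hx'.trans_le (min_le_right _ _)
      rw [dist_comm, dist_eq_norm]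
      simp only [hιv]
      calc _ ≤ _ := h1
        _ ≤ 1 * dist x' x := by gcongr
        _ < ε := by linarith
  refine ⟨ι ⁻¹' closure T, hce.isCompact_preimage hcomp, ?_⟩
  filter_upwards [Metric.closedBall_mem_nhds (0 : auxA K) one_pos] with w hw
  exact subset_closure ⟨_, ⟨w, hw, rfl⟩, rfl⟩

theorem aux_J_exists {c : ℂ} {K : Set ℂ} [CompactSpace K] (hK : AuxNice c K) :
    ∃ J : auxA K →L[ℂ] auxA K, AuxInt c K J := by
  obtain ⟨C, hC, hb⟩ := hK.bound
  set e : Polynomial ℂ →ₗ[ℂ] auxA K := (auxP K).toLinearMap ∘ₗ Polynomial.derivative with he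
  set f : Polynomial ℂ →ₗ[ℂ] auxA K := (auxP K).toLinearMap -
    (Algebra.linearMap ℂ (auxA K)) ∘ₗ (Polynomial.leval c) with hf
  have hfe : ∀ P, f P = auxP K (P - Polynomial.C (P.eval c)) := by
    intro P
    simp only [hf, LinearMap.sub_apply, map_sub]
    congr 1
    simp only [LinearMap.comp_apply, Algebra.linearMap_apply, Polynomial.leval_apply]
    exact ((auxP K).commutes _).symm
  have hd : DenseRange e := by
    have : Set.range e = Set.range (auxP K) := by
      ext w; constructor
      · rintro ⟨P, rfl⟩; exact ⟨_, rfl⟩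
      · rintro ⟨P, rfl⟩
        obtain ⟨R, rfl⟩ := aux_derivative_surj P
        exact ⟨R, rfl⟩
    rw [DenseRange, this]; exact auxP_dense K
  have hn : ∀ P, ‖f P‖ ≤ C * ‖e P‖ := by
    intro P
    rw [aux_A_norm_le _ (by positivity)]
    intro x
    rw [hfe, auxP_apply]
    have := hb (fun z => P.eval z) (fun z => (Polynomial.derivative P).eval z)
      ‖e P‖ (fun z _ => P.hasDerivAt z)
      (fun z hz => by
        have := aux_A_le_norm (auxP K (Polynomial.derivative P)) ⟨z, hz⟩
        rwa [auxP_apply] at this) x x.2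
    rw [Polynomial.eval_sub, Polynomial.eval_C]
    exact this
  refine ⟨f.extendOfNorm e, fun P => ?_⟩
  rw [← hfe]
  exact LinearMap.extendOfNorm_eq hd ⟨C, hn⟩ P

end P4b

section P4c
open Filter Topology MeasureTheory

theorem aux_J_deriv {c : ℂ} {K : Set ℂ} [CompactSpace K]
    {J : auxA K →L[ℂ] auxA K} (hJ : AuxInt c K J) (w : auxA K) (F F' : ℂ → ℂ)
    (hF : ∀ x : K, F x = (J w : C(K, ℂ)) x) (hF' : ∀ x : K, F' x = (w : C(K, ℂ)) x)
    (x : ℂ) (hx : x ∈ interior K) : HasDerivAt F (F' x) x := by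
  obtain ⟨s, hs, hlim⟩ := mem_closure_iff_seq_limit.1 (auxP_dense K w)
  choose P hP using hs
  choose R hR using fun n => aux_derivative_surj (P n)
  have hP' : ∀ n, auxP K (Polynomial.derivative (R n)) = s n := fun n => by rw [hR, hP]
  have h1 : TendstoUniformlyOn (fun n z => (Polynomial.derivative (R n)).eval z) F' atTop
      (interior K) := by
    rw [Metric.tendstoUniformlyOn_iff]
    intro ε hε
    filter_upwards [Metric.tendsto_nhds.1 hlim ε hε] with n hn z hz
    have hzK := interior_subset hz
    have h2 := aux_A_le_norm (s n - w) ⟨z, hzK⟩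
    rw [← dist_eq_norm] at h2
    refine lt_of_le_of_lt ?_ hn
    have e : (Polynomial.derivative (R n)).eval z - F' z =
        ((s n - w : auxA K) : C(K, ℂ)) ⟨z, hzK⟩ := by
      rw [← hP' n, hF' ⟨z, hzK⟩]
      change _ = (auxP K (Polynomial.derivative (R n)) : C(K, ℂ)) ⟨z, hzK⟩ - _
      rw [auxP_apply]
    rw [dist_comm, dist_eq_norm, e]
    exact h2
  have h3 : ∀ z ∈ interior K, Tendsto (fun n => (R n - Polynomial.C ((R n).eval c)).eval z) atTop
      (𝓝 (F z)) := by
    intro z hz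
    have hzK := interior_subset hz
    rw [hF ⟨z, hzK⟩]
    have := (((aux_A_eval_cont ⟨z, hzK⟩).comp J.continuous).tendsto w).comp hlim
    refine this.congr fun n => ?_
    simp only [Function.comp_apply]
    rw [← hP' n, hJ, auxP_apply]
  refine hasDerivAt_of_tendstoUniformlyOn isOpen_interior h1 (Eventually.of_forall ?_) h3 hx
  intro n z _
  have := (R n - Polynomial.C ((R n).eval c)).hasDerivAt z
  simpa only [Polynomial.derivative_sub, Polynomial.derivative_C, sub_zero] using this

theorem aux_J_restrict {c : ℂ} {K K' : Set ℂ} [CompactSpace K] [CompactSpace K'] (hKK : K ⊆ K')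
    {J : auxA K →L[ℂ] auxA K} (hJ : AuxInt c K J)
    {J' : auxA K' →L[ℂ] auxA K'} (hJ' : AuxInt c K' J') (w : auxA K') :
    ∃ v : auxA K, (∀ x (hx : x ∈ K), (v : C(K, ℂ)) ⟨x, hx⟩ = (w : C(K', ℂ)) ⟨x, hKK hx⟩) ∧
      (∀ x (hx : x ∈ K), (J v : C(K, ℂ)) ⟨x, hx⟩ = (J' w : C(K', ℂ)) ⟨x, hKK hx⟩) := by
  set i : C(K, K') := ⟨Set.inclusion hKK, continuous_inclusion hKK⟩ with hi
  have hrc : Continuous fun w : auxA K' => (w : C(K', ℂ)).comp i :=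
    (ContinuousMap.continuous_precomp i).comp continuous_subtype_val
  have hmem : ∀ w : auxA K', (w : C(K', ℂ)).comp i ∈ auxA K := by
    intro w
    refine (auxP_dense K').induction_on
      (p := fun w : auxA K' => (w : C(K', ℂ)).comp i ∈ auxA K) w
      ((aux_A_closed K).preimage hrc) ?_
    intro P
    have : (auxP K' P : C(K', ℂ)).comp i = (auxP K P : C(K, ℂ)) := by
      ext x; rfl
    rw [this]; exact (auxP K P).2
  set r : auxA K' → auxA K := fun w => ⟨(w : C(K', ℂ)).comp i, hmem w⟩ with hr
  have hrcont : Continuous r := hrc.subtype_mk _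
  have hrP : ∀ P, r (auxP K' P) = auxP K P := fun P => by
    apply Subtype.ext; ext x; rfl
  have hcomm : J (r w) = r (J' w) := by
    refine (auxP_dense K').induction_on (p := fun w : auxA K' => J (r w) = r (J' w)) w
      (isClosed_eq (J.continuous.comp hrcont) (hrcont.comp J'.continuous)) ?_
    intro P
    obtain ⟨R, rfl⟩ := aux_derivative_surj P
    rw [hrP, hJ, hJ', hrP]
  refine ⟨r w, fun x hx => rfl, fun x hx => ?_⟩
  rw [hcomm]; rfl

theorem aux_J_holo {c : ℂ} {K : Set ℂ} [CompactSpace K] (hK : AuxNice c K)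
    {J : auxA K →L[ℂ] auxA K} (hJ : AuxInt c K J) (w : auxA K) (F F' : ℂ → ℂ)
    (hF : ∀ x ∈ K, HasDerivAt F (F' x) x) (hF' : ∀ x : K, F' x = (w : C(K, ℂ)) x) (x : K) :
    (J w : C(K, ℂ)) x = F x - F c := by
  obtain ⟨C, hC, hb⟩ := hK.bound
  have hcl : IsClosed {v : auxA K | ‖(J v : C(K, ℂ)) x - (F x - F c)‖ ≤ C * ‖v - w‖} := by
    refine isClosed_le ?_ (by fun_prop)
    exact (((aux_A_eval_cont x).comp J.continuous).sub continuous_const).norm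
  have := (auxP_dense K).induction_on (p := fun v => v ∈ {v : auxA K |
      ‖(J v : C(K, ℂ)) x - (F x - F c)‖ ≤ C * ‖v - w‖}) w hcl ?_
  · rw [Set.mem_ofPred_eq, sub_self, norm_zero, mul_zero] at this
    exact sub_eq_zero.1 (norm_le_zero_iff.1 this)
  · intro P
    obtain ⟨R, rfl⟩ := aux_derivative_surj P
    rw [Set.mem_ofPred_eq, hJ R, auxP_apply]
    have := hb (fun z => R.eval z - F z) (fun z => (Polynomial.derivative R).eval z - F' z)
      ‖auxP K (Polynomial.derivative R) - w‖ (fun z hz => (R.hasDerivAt z).sub (hF z hz))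
      (fun z hz => by
        have := aux_A_le_norm (auxP K (Polynomial.derivative R) - w) ⟨z, hz⟩
        rw [hF' ⟨z, hz⟩]
        exact this) x x.2
    rw [Polynomial.eval_sub, Polynomial.eval_C]
    convert this using 2
    ring

theorem aux_div_bound {K : Set ℂ} [CompactSpace K] (p : ℂ) (hp : p ∈ interior K) :
    ∃ r : ℝ, 0 < r ∧ ∀ h : auxA K,
      r * ‖h‖ ≤ ‖auxP K (Polynomial.X - Polynomial.C p) * h‖ := by
  obtain ⟨r, hr, hb⟩ := Metric.nhds_basis_closedBall.mem_iff.1 (isOpen_interior.mem_nhds hp)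
  have hbK : Metric.closedBall p r ⊆ K := hb.trans interior_subset
  refine ⟨r, hr, fun h => ?_⟩
  refine (auxP_dense K).induction_on (p := fun h : auxA K =>
    r * ‖h‖ ≤ ‖auxP K (Polynomial.X - Polynomial.C p) * h‖) h
    (isClosed_le (by fun_prop) (by fun_prop)) ?_
  intro P
  set M := ‖auxP K (Polynomial.X - Polynomial.C p) * auxP K P‖ with hM
  have hM0 : 0 ≤ M := norm_nonneg _
  have h1 : ∀ x ∈ K, ‖x - p‖ * ‖P.eval x‖ ≤ M := by
    intro x hx
    have := aux_A_le_norm (auxP K (Polynomial.X - Polynomial.C p) * auxP K P) ⟨x, hx⟩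
    rw [← map_mul, auxP_apply, Polynomial.eval_mul, norm_mul, map_mul] at this
    simpa only [Polynomial.eval_sub, Polynomial.eval_X, Polynomial.eval_C] using this
  have h2 : ∀ x ∈ K, r ≤ ‖x - p‖ → ‖P.eval x‖ ≤ M / r := by
    intro x hx hrx
    rw [le_div_iff₀ hr, mul_comm]
    exact (mul_le_mul_of_nonneg_right hrx (norm_nonneg _)).trans (h1 x hx)
  rw [mul_comm, ← le_div_iff₀ hr, aux_A_norm_le _ (by positivity)]
  intro x
  rw [auxP_apply]
  rcases le_or_gt r ‖(x:ℂ) - p‖ with hx | hx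
  · exact h2 x x.2 hx
  · refine Complex.norm_le_of_forall_mem_frontier_norm_le (U := Metric.ball p r)
      Metric.isBounded_ball (f := fun z => P.eval z) P.differentiable.diffContOnCl ?_ ?_
    · intro z hz
      rw [frontier_ball _ hr.ne', mem_sphere_iff_norm] at hz
      refine h2 z (hbK ?_) hz.ge
      rw [mem_closedBall_iff_norm]; exact hz.le
    · refine subset_closure ?_
      rw [mem_ball_iff_norm]; exact hx

theorem aux_div {K : Set ℂ} [CompactSpace K] (p : ℂ) (hp : p ∈ interior K)
    (f : auxA K) (hf : (f : C(K, ℂ)) ⟨p, interior_subset hp⟩ = 0) :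
    ∃ h : auxA K, auxP K (Polynomial.X - Polynomial.C p) * h = f := by
  obtain ⟨r, hr, hb⟩ := aux_div_bound p hp
  set q : K := ⟨p, interior_subset hp⟩ with hq
  set L : auxA K →L[ℂ] auxA K :=
    ContinuousLinearMap.mul ℂ (auxA K) (auxP K (Polynomial.X - Polynomial.C p)) with hL
  have hanti : AntilipschitzWith (Real.toNNReal r⁻¹) L := by
    refine L.antilipschitz_of_bound fun h => ?_
    rw [Real.coe_toNNReal _ (by positivity)]
    have := hb h
    rw [inv_mul_eq_div, le_div_iff₀ hr, mul_comm]
    exact this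
  have hcl : IsClosed (Set.range L) := hanti.isClosed_range L.uniformContinuous
  set E : auxA K → auxA K := fun f => f - algebraMap ℂ (auxA K) ((f : C(K, ℂ)) q) with hE
  have hEc : Continuous E :=
    continuous_id.sub ((continuous_algebraMap ℂ (auxA K)).comp (aux_A_eval_cont q))
  have : ∀ f, E f ∈ Set.range L := by
    intro f
    refine (auxP_dense K).induction_on (p := fun f : auxA K => E f ∈ Set.range L) f
      (hcl.preimage hEc) ?_
    intro P
    obtain ⟨R, hR⟩ := Polynomial.X_sub_C_dvd_sub_C_eval (a := p) (p := P)
    refine ⟨auxP K R, ?_⟩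
    change auxP K (Polynomial.X - Polynomial.C p) * auxP K R = _
    rw [← map_mul, ← hR, map_sub, hE]
    simp only
    rw [auxP_apply]
    congr 1
    exact (auxP K).commutes _
  obtain ⟨h, hh⟩ := this f
  refine ⟨h, ?_⟩
  have : E f = f := by
    rw [hE]; simp only; rw [hf, map_zero, sub_zero]
  rw [← this]; exact hh

end P4c

section P4d
open Filter Topology MeasureTheory

/-- the polynomial `Q` -/
noncomputable def auxQ {m : ℕ} (p : Fin m → ℂ) : Polynomial ℂ :=
  ∏ j, (Polynomial.X - Polynomial.C (p j))

theorem aux_div_prod {K : Set ℂ} [CompactSpace K] {m : ℕ} (p : Fin m → ℂ)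
    (hp : Function.Injective p) (hpK : ∀ j, p j ∈ interior K) (s : Finset (Fin m)) :
    ∀ (f : auxA K), (∀ j ∈ s, (f : C(K, ℂ)) ⟨p j, interior_subset (hpK j)⟩ = 0) →
    ∃ h : auxA K, auxP K (∏ j ∈ s, (Polynomial.X - Polynomial.C (p j))) * h = f := by
  classical
  induction s using Finset.induction_on with
  | empty => intro f _; exact ⟨f, by simp⟩
  | insert a s ha ih =>
    intro f hf
    obtain ⟨h, hh⟩ := aux_div (p a) (hpK a) f (hf a (Finset.mem_insert_self _ _))
    obtain ⟨h', hh'⟩ := ih h (by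
      intro j hj
      have h1 := hf j (Finset.mem_insert_of_mem hj)
      rw [← hh] at h1
      change (auxP K (Polynomial.X - Polynomial.C (p a)) : C(K, ℂ)) _ * _ = 0 at h1
      rw [auxP_apply, mul_eq_zero] at h1
      rcases h1 with h1 | h1
      · rw [Polynomial.eval_sub, Polynomial.eval_X, Polynomial.eval_C, sub_eq_zero] at h1
        exact absurd (hp h1) (fun e => ha (e ▸ hj))
      · exact h1)
    refine ⟨h', ?_⟩
    rw [Finset.prod_insert ha, map_mul, mul_assoc, hh', hh]

theorem aux_Q_inj {K : Set ℂ} [CompactSpace K] {m : ℕ} (p : Fin m → ℂ)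
    (hpK : ∀ j, p j ∈ interior K) (s : Finset (Fin m)) :
    ∀ (f : auxA K), auxP K (∏ j ∈ s, (Polynomial.X - Polynomial.C (p j))) * f = 0 → f = 0 := by
  classical
  induction s using Finset.induction_on with
  | empty => intro f hf; simpa using hf
  | insert a s ha ih =>
    intro f hf
    apply ih
    rw [Finset.prod_insert ha, map_mul, mul_assoc] at hf
    obtain ⟨r, hr, hb⟩ := aux_div_bound (p a) (hpK a)
    have := hb (auxP K (∏ j ∈ s, (Polynomial.X - Polynomial.C (p j))) * f)
    rw [hf, norm_zero] at this
    have h2 : ‖auxP K (∏ j ∈ s, (Polynomial.X - Polynomial.C (p j))) * f‖ ≤ 0 := by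
      by_contra! h
      have := mul_pos hr h
      linarith
    exact norm_le_zero_iff.1 h2

/-- the model scalar operator -/
noncomputable def auxMs (K : Set ℂ) [CompactSpace K] {m : ℕ} (p : Fin m → ℂ) :
    (auxA K × (Fin m → ℂ)) →L[ℂ] auxA K :=
  (ContinuousLinearMap.mul ℂ (auxA K) (auxP K (auxQ p))).comp (ContinuousLinearMap.fst ℂ _ _) +
    ∑ k : Fin m, ((ContinuousLinearMap.proj k).comp
      (ContinuousLinearMap.snd ℂ (auxA K) (Fin m → ℂ))).smulRight
      (auxP K (Polynomial.X ^ (k : ℕ)))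

theorem auxMs_apply (K : Set ℂ) [CompactSpace K] {m : ℕ} (p : Fin m → ℂ) (w : auxA K)
    (φ : Fin m → ℂ) : auxMs K p (w, φ) =
      auxP K (auxQ p) * w + ∑ k : Fin m, φ k • auxP K (Polynomial.X ^ (k : ℕ)) := by
  simp [auxMs]

theorem auxMs_eval (K : Set ℂ) [CompactSpace K] {m : ℕ} (p : Fin m → ℂ) (w : auxA K)
    (φ : Fin m → ℂ) (x : K) : (auxMs K p (w, φ) : C(K, ℂ)) x =
      (auxQ p).eval (x : ℂ) * (w : C(K, ℂ)) x + ∑ k : Fin m, φ k * (x : ℂ) ^ (k : ℕ) := by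
  set ev : auxA K →ₗ[ℂ] ℂ := (ContinuousMap.evalCLM ℂ x).toLinearMap.comp
      (Subalgebra.toSubmodule (auxA K)).subtype with hev
  have h0 : ∀ f : auxA K, (f : C(K, ℂ)) x = ev f := fun f => rfl
  rw [auxMs_apply, h0, map_add, map_sum]
  congr 1
  refine Finset.sum_congr rfl fun k _ => ?_
  rw [map_smul, ← h0, auxP_apply, smul_eq_mul, Polynomial.eval_pow, Polynomial.eval_X]

theorem auxMs_bij (K : Set ℂ) [CompactSpace K] {m : ℕ} (p : Fin m → ℂ)
    (hp : Function.Injective p) (hpK : ∀ j, p j ∈ interior K) :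
    Function.Bijective (auxMs K p) := by
  have hQ : ∀ j, (auxQ p).eval (p j) = 0 := by
    intro j
    rw [auxQ, Polynomial.eval_prod]
    exact Finset.prod_eq_zero (Finset.mem_univ j) (by simp)
  have hdet : (Matrix.vandermonde p).det ≠ 0 := Matrix.det_vandermonde_ne_zero_iff.2 hp
  have hunit : IsUnit (Matrix.vandermonde p) :=
    (Matrix.isUnit_iff_isUnit_det _).2 (isUnit_iff_ne_zero.2 hdet)
  have hv : ∀ (φ : Fin m → ℂ) j, (Matrix.vandermonde p).mulVec φ j =
      ∑ k : Fin m, φ k * p j ^ (k : ℕ) := by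
    intro φ j
    simp [Matrix.mulVec, dotProduct, Matrix.vandermonde_apply, mul_comm]
  constructor
  · rw [injective_iff_map_eq_zero]
    rintro ⟨w, φ⟩ h
    have hφ : φ = 0 := by
      apply Matrix.mulVec_injective_of_isUnit hunit
      rw [Matrix.mulVec_zero]
      ext j
      have h1 := auxMs_eval K p w φ ⟨p j, interior_subset (hpK j)⟩
      rw [h, hQ, zero_mul, zero_add] at h1
      rw [hv, ← h1]; rfl
    rw [auxMs_apply, hφ] at h
    simp only [Pi.zero_apply, zero_smul, Finset.sum_const_zero, add_zero] at h
    rw [aux_Q_inj p hpK Finset.univ w h, hφ]; rfl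
  · intro f
    obtain ⟨φ, hφ⟩ := (Matrix.mulVec_surjective_iff_isUnit.2 hunit)
      (fun j => (f : C(K, ℂ)) ⟨p j, interior_subset (hpK j)⟩)
    obtain ⟨h, hh⟩ := aux_div_prod p hp hpK Finset.univ (f - auxMs K p (0, φ)) (by
      intro j _
      change (f : C(K, ℂ)) _ - (auxMs K p (0, φ) : C(K, ℂ)) _ = 0
      rw [auxMs_eval, hQ, zero_mul, zero_add, ← hv, hφ, sub_self])
    refine ⟨(h, φ), ?_⟩
    change auxP K (auxQ p) * h = _ at hh
    rw [auxMs_apply, hh, auxMs_apply, mul_zero, zero_add, sub_add_cancel]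

end P4d

section P5a
open Filter Topology MeasureTheory

/-- the polynomial matrix `Q B` -/
noncomputable def auxC {N m : ℕ} (p : Fin m → ℂ) (B : Fin m → Matrix (Fin N) (Fin N) ℂ)
    (i j : Fin N) : Polynomial ℂ :=
  ∑ l, Polynomial.C (B l i j) * ∏ k ∈ Finset.univ.erase l, (Polynomial.X - Polynomial.C (p k))

theorem auxQ_natDegree {m : ℕ} (p : Fin m → ℂ) : (auxQ p).natDegree = m := by
  rw [auxQ, Polynomial.natDegree_prod_of_monic _ _ (fun j _ => Polynomial.monic_X_sub_C _)]
  simp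

theorem auxQ_monic {m : ℕ} (p : Fin m → ℂ) : (auxQ p).Monic :=
  Polynomial.monic_prod_of_monic _ _ (fun j _ => Polynomial.monic_X_sub_C _)

theorem auxC_coeff_top {N S : ℕ} (p : Fin (S + 2) → ℂ)
    (B : Fin (S + 2) → Matrix (Fin N) (Fin N) ℂ) (i j : Fin N) :
    (auxC p B i j).coeff (S + 1) = (∑ l, B l) i j := by
  rw [auxC, Polynomial.finsetSum_coeff, Matrix.sum_apply]
  refine Finset.sum_congr rfl fun l _ => ?_
  have hm : (∏ k ∈ Finset.univ.erase l, (Polynomial.X - Polynomial.C (p k))).Monic :=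
    Polynomial.monic_prod_of_monic _ _ (fun j _ => Polynomial.monic_X_sub_C _)
  have hd : (∏ k ∈ Finset.univ.erase l, (Polynomial.X - Polynomial.C (p k))).natDegree = S + 1 := by
    rw [Polynomial.natDegree_prod_of_monic _ _ (fun j _ => Polynomial.monic_X_sub_C _)]
    simp
  rw [Polynomial.coeff_C_mul, ← hd, hm.coeff_natDegree, mul_one]

theorem auxC_coeff_gt {N S : ℕ} (p : Fin (S + 2) → ℂ)
    (B : Fin (S + 2) → Matrix (Fin N) (Fin N) ℂ) (i j : Fin N) (n : ℕ) (hn : S + 1 < n) :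
    (auxC p B i j).coeff n = 0 := by
  rw [auxC, Polynomial.finsetSum_coeff]
  refine Finset.sum_eq_zero fun l _ => ?_
  have hd : (∏ k ∈ Finset.univ.erase l, (Polynomial.X - Polynomial.C (p k))).natDegree = S + 1 := by
    rw [Polynomial.natDegree_prod_of_monic _ _ (fun j _ => Polynomial.monic_X_sub_C _)]
    simp
  rw [Polynomial.coeff_C_mul, Polynomial.coeff_eq_zero_of_natDegree_lt (by omega), mul_zero]

theorem aux_poly_surj {N S : ℕ} (p : Fin (S + 2) → ℂ)
    (B : Fin (S + 2) → Matrix (Fin N) (Fin N) ℂ)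
    (hinv : ∀ k : ℕ, IsUnit ((k : ℂ) • (1 : Matrix (Fin N) (Fin N) ℂ) + ∑ j, B j)) (n : ℕ) :
    ∀ G : Fin N → Polynomial ℂ, (∀ i k, n ≤ k → (G i).coeff k = 0) →
    ∃ (F : Fin N → Polynomial ℂ) (φ : Fin N → Fin (S + 1) → ℂ), ∀ i,
      auxQ p * Polynomial.derivative (F i) + ∑ j, auxC p B i j * F j +
        ∑ k : Fin (S + 1), Polynomial.C (φ i k) * Polynomial.X ^ (k : ℕ) = G i := by
  induction n with
  | zero =>
    intro G hG
    refine ⟨0, 0, fun i => ?_⟩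
    have : G i = 0 := by ext k; simpa using hG i k (Nat.zero_le _)
    simp [this]
  | succ n ih =>
    intro G hG
    rcases le_or_gt n S with hn | hn
    · refine ⟨0, fun i k => (G i).coeff k, fun i => ?_⟩
      simp only [Pi.zero_apply, map_zero, mul_zero, Finset.sum_const_zero, add_zero, zero_add]
      rw [Fin.sum_univ_eq_sum_range
        (fun k => Polynomial.C ((G i).coeff k) * Polynomial.X ^ k) (S + 1)]
      ext d
      rw [Polynomial.finsetSum_coeff]
      simp only [Polynomial.coeff_C_mul, Polynomial.coeff_X_pow, mul_ite, mul_one, mul_zero,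
        Finset.sum_ite_eq, Finset.mem_range]
      split_ifs with hd
      · rfl
      · exact (hG i d (by omega)).symm
    · obtain ⟨a, rfl⟩ : ∃ a, n = a + (S + 1) := ⟨n - (S + 1), by omega⟩
      obtain ⟨u, hu⟩ := (Matrix.mulVec_surjective_iff_isUnit.2 (hinv a))
        (fun i => (G i).coeff (a + (S + 1)))
      set F0 : Fin N → Polynomial ℂ := fun i => Polynomial.C (u i) * Polynomial.X ^ a with hF0
      set L0 : Fin N → Polynomial ℂ := fun i =>
        auxQ p * Polynomial.derivative (F0 i) + ∑ j, auxC p B i j * F0 j with hL0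
      have hC : ∀ i j k, (auxC p B i j * F0 j).coeff (k + a) = (auxC p B i j).coeff k * u j := by
        intro i j k
        rw [hF0]; simp only
        rw [← mul_assoc, Polynomial.coeff_mul_X_pow, Polynomial.coeff_mul_C]
      have hQ : ∀ i k, (auxQ p * Polynomial.derivative (F0 i)).coeff (k + a) =
          (auxQ p).coeff (k + 1) * (a * u i) := by
        intro i k
        rw [hF0]; simp only
        rw [Polynomial.derivative_C_mul_X_pow]
        rcases a with _ | a
        · simp
        · rw [Nat.add_sub_cancel, ← mul_assoc, show k + (a + 1) = (k + 1) + a by ring,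
            Polynomial.coeff_mul_X_pow, Polynomial.coeff_mul_C]
          ring
      have hL : ∀ i k, a + (S + 1) ≤ k → (G i - L0 i).coeff k = 0 := by
        intro i k hk
        obtain ⟨b, rfl⟩ : ∃ b, k = b + a := ⟨k - a, by omega⟩
        rw [Polynomial.coeff_sub, hL0]
        simp only
        rw [Polynomial.coeff_add, Polynomial.finsetSum_coeff, hQ]
        simp only [hC]
        rcases eq_or_lt_of_le (show S + 1 ≤ b by omega) with rfl | hb
        · have h1 : (auxQ p).coeff (S + 1 + 1) = 1 := by
            have := (auxQ_monic p).coeff_natDegree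
            rwa [auxQ_natDegree] at this
          have h2 := congrFun hu i
          simp only [auxC_coeff_top, h1]
          rw [Matrix.add_mulVec, Matrix.smul_mulVec, Matrix.one_mulVec, Pi.add_apply,
            Pi.smul_apply, smul_eq_mul] at h2
          rw [add_comm (S + 1) a, ← h2, Matrix.mulVec, dotProduct]
          ring
        · rw [hG i _ (by omega), Polynomial.coeff_eq_zero_of_natDegree_lt
            (by rw [auxQ_natDegree]; omega)]
          simp [auxC_coeff_gt p B _ _ b hb]
      obtain ⟨F, φ, hF⟩ := ih (fun i => G i - L0 i) hL
      refine ⟨fun i => F i + F0 i, φ, fun i => ?_⟩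
      have := hF i
      simp only [hL0] at this
      simp only [map_add, mul_add, Finset.sum_add_distrib]
      linear_combination this

end P5a

section P5b
open Filter Topology MeasureTheory

theorem aux_compact_functional {Y Z : Type*} [NormedAddCommGroup Y] [NormedSpace ℂ Y]
    [NormedAddCommGroup Z] [NormedSpace ℂ Z] (l : Y →L[ℂ] ℂ) (z : Z) :
    IsCompactOperator (l.smulRight z) := by
  have h1 : IsCompactOperator l := by
    refine ⟨Metric.closedBall 0 1, isCompact_closedBall _ _, ?_⟩
    apply l.continuous.continuousAt.preimage_mem_nhds
    rw [map_zero]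
    exact Metric.closedBall_mem_nhds 0 one_pos
  exact h1.clm_comp (ContinuousLinearMap.toSpanSingleton ℂ z)

theorem aux_compact_sum {Y Z ι : Type*} [NormedAddCommGroup Y] [NormedSpace ℂ Y]
    [NormedAddCommGroup Z] [NormedSpace ℂ Z] (s : Finset ι) (f : ι → Y →L[ℂ] Z)
    (hf : ∀ i ∈ s, IsCompactOperator (f i)) : IsCompactOperator (∑ i ∈ s, f i : Y →L[ℂ] Z) := by
  classical
  induction s using Finset.induction_on with
  | empty => exact isCompactOperator_zero
  | insert a s ha ih =>
    rw [Finset.sum_insert ha]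
    exact (hf a (Finset.mem_insert_self _ _)).add
      (ih fun i hi => hf i (Finset.mem_insert_of_mem hi))

theorem aux_compact_pi {Y Z ι : Type*} [Fintype ι] [NormedAddCommGroup Y] [NormedSpace ℂ Y]
    [NormedAddCommGroup Z] [NormedSpace ℂ Z] (f : ι → Y →L[ℂ] Z)
    (hf : ∀ i, IsCompactOperator (f i)) : IsCompactOperator (ContinuousLinearMap.pi f) := by
  classical
  have : ContinuousLinearMap.pi f = ∑ i, (ContinuousLinearMap.single ℂ (fun _ : ι => Z) i).comp
      (f i) := by
    ext y i
    simp [Finset.sum_apply, Pi.single_apply]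
  rw [this]
  exact aux_compact_sum _ _ fun i _ => by
    exact (hf i).clm_comp (ContinuousLinearMap.single ℂ (fun _ : ι => Z) i)

theorem aux_compact_add {Y Z : Type*} [NormedAddCommGroup Y] [NormedSpace ℂ Y]
    [NormedAddCommGroup Z] [NormedSpace ℂ Z] (f g : Y →L[ℂ] Z)
    (hf : IsCompactOperator f) (hg : IsCompactOperator g) :
    IsCompactOperator (f + g : Y →L[ℂ] Z) := hf.add hg

theorem aux_compact_clm_comp {Y Z V : Type*} [NormedAddCommGroup Y] [NormedSpace ℂ Y]
    [NormedAddCommGroup Z] [NormedSpace ℂ Z] [NormedAddCommGroup V] [NormedSpace ℂ V]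
    (f : Y →L[ℂ] Z) (g : Z →L[ℂ] V)
    (hf : IsCompactOperator f) : IsCompactOperator (g.comp f) := hf.clm_comp g

theorem aux_compact_comp_clm {Y Z V : Type*} [NormedAddCommGroup Y] [NormedSpace ℂ Y]
    [NormedAddCommGroup Z] [NormedSpace ℂ Z] [NormedAddCommGroup V] [NormedSpace ℂ V]
    (f : Y →L[ℂ] Z) (g : Z →L[ℂ] V)
    (hg : IsCompactOperator g) : IsCompactOperator (g.comp f) := hg.comp_clm f

theorem aux_T_bij {N S : ℕ} (p : Fin (S + 2) → ℂ) (hp : Function.Injective p)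
    (B : Fin (S + 2) → Matrix (Fin N) (Fin N) ℂ)
    (hinv : ∀ k : ℕ, IsUnit ((k : ℂ) • (1 : Matrix (Fin N) (Fin N) ℂ) + ∑ j, B j))
    {c : ℂ} {K : Set ℂ} [CompactSpace K] (hK : AuxNice c K) (hpK : ∀ j, p j ∈ interior K)
    {J : auxA K →L[ℂ] auxA K} (hJ : AuxInt c K J) :
    Function.Bijective (fun (W : Fin N → auxA K × (Fin (S + 2) → ℂ)) (i : Fin N) =>
      auxP K (auxQ p) * (W i).1 +
      ∑ j, auxP K (auxC p B i j) * (J (W j).1 + (W j).2 (Fin.last (S + 1)) • 1) +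
      ∑ k : Fin (S + 1), (W i).2 k.castSucc • auxP K (Polynomial.X ^ (k : ℕ))) := by
  set Y := Fin N → auxA K × (Fin (S + 2) → ℂ) with hY
  set M : Y →L[ℂ] (Fin N → auxA K) :=
    ContinuousLinearMap.pi fun i => (auxMs K p).comp (ContinuousLinearMap.proj i) with hM
  have hMb : Function.Bijective M := by
    have h := auxMs_bij K p hp hpK
    constructor
    · intro a b hab
      funext i
      exact h.1 (congrFun hab i)
    · intro z
      choose a ha using fun i => h.2 (z i)
      exact ⟨a, funext ha⟩
  set w : Fin N → Y →L[ℂ] auxA K := fun j =>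
    (ContinuousLinearMap.fst ℂ _ _).comp (ContinuousLinearMap.proj j) with hw
  set l : Fin N → Y →L[ℂ] ℂ := fun j => (ContinuousLinearMap.proj (Fin.last (S + 1))).comp
    ((ContinuousLinearMap.snd ℂ (auxA K) (Fin (S + 2) → ℂ)).comp
      (ContinuousLinearMap.proj j)) with hl
  set κi : Fin N → Y →L[ℂ] auxA K := fun i =>
    (∑ j, (ContinuousLinearMap.mul ℂ (auxA K) (auxP K (auxC p B i j))).comp
      (J.comp (w j) + (l j).smulRight 1)) +
      (-(l i)).smulRight (auxP K (Polynomial.X ^ (S + 1))) with hκi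
  have hκ : IsCompactOperator (ContinuousLinearMap.pi κi) := by
    refine aux_compact_pi _ fun i => aux_compact_add _ _ ?_ (aux_compact_functional _ _)
    refine aux_compact_sum _ _ fun j _ => aux_compact_clm_comp _ _ ?_
    exact aux_compact_add _ _ (aux_compact_comp_clm _ _ (aux_J_compact hK hJ))
      (aux_compact_functional _ _)
  have hT : (fun (W : Fin N → auxA K × (Fin (S + 2) → ℂ)) (i : Fin N) =>
      auxP K (auxQ p) * (W i).1 +
      ∑ j, auxP K (auxC p B i j) * (J (W j).1 + (W j).2 (Fin.last (S + 1)) • 1) +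
      ∑ k : Fin (S + 1), (W i).2 k.castSucc • auxP K (Polynomial.X ^ (k : ℕ))) =
      fun W => M W + ContinuousLinearMap.pi κi W := by
    funext W i
    have e1 : M W i = auxMs K p ((W i).1, (W i).2) := rfl
    have e2 : ContinuousLinearMap.pi κi W i =
      (∑ j, auxP K (auxC p B i j) * (J (W j).1 + (W j).2 (Fin.last (S + 1)) • 1)) +
      (-(W i).2 (Fin.last (S + 1))) • (auxP K (Polynomial.X ^ (S + 1))) := by
      simp only [hκi, ContinuousLinearMap.coe_pi', add_apply, sum_apply]
      rfl
    rw [Pi.add_apply, e1, e2, auxMs_apply,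
      Fin.sum_univ_castSucc (n := S + 1)
        (fun k : Fin (S + 2) => (W i).2 k • auxP K (Polynomial.X ^ (k : ℕ)))]
    simp only [Fin.val_castSucc, Fin.val_last, neg_smul]
    abel
  rw [hT]
  refine aux_fredholm M _ hMb hκ ?_
  have hsub : (Set.univ.pi fun _ : Fin N => Set.range (auxP K)) ⊆
      Set.range (fun W => M W + ContinuousLinearMap.pi κi W) := by
    intro z hz
    choose G hG using fun i => hz i trivial
    obtain ⟨n, hn⟩ : ∃ n, ∀ i, (G i).natDegree < n := by
      refine ⟨(∑ i, (G i).natDegree) + 1, fun i => Nat.lt_succ_of_le ?_⟩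
      exact Finset.single_le_sum (f := fun i => (G i).natDegree) (fun _ _ => Nat.zero_le _)
        (Finset.mem_univ i)
    obtain ⟨F, φ, hF⟩ := aux_poly_surj p B hinv n G (fun i k hk =>
      Polynomial.coeff_eq_zero_of_natDegree_lt ((hn i).trans_le hk))
    rw [← hT]
    refine ⟨fun i => (auxP K (Polynomial.derivative (F i)),
      Fin.snoc (φ i) ((F i).eval c)), ?_⟩
    funext i
    simp only [Fin.snoc_last, Fin.snoc_castSucc]
    have h1 : ∀ j, J (auxP K (Polynomial.derivative (F j))) + (F j).eval c • 1 =
        auxP K (F j) := by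
      intro j
      rw [hJ, map_sub, ← Algebra.algebraMap_eq_smul_one, ← (auxP K).commutes]
      exact sub_add_cancel _ _
    simp only [h1]
    rw [← hG i, ← hF i]
    simp only [map_add, map_sum, map_mul]
    congr 1
    refine Finset.sum_congr rfl fun k _ => ?_
    rw [Algebra.smul_def, ← (auxP K).commutes]
    rfl
  refine Dense.mono hsub ?_
  exact dense_pi _ fun i _ => auxP_dense K

end P5b

section P6
open Filter Topology MeasureTheory

/-- solution of the integrated equation on `K` -/
def AuxSol {N S : ℕ} (p : Fin (S + 2) → ℂ) (B : Fin (S + 2) → Matrix (Fin N) (Fin N) ℂ)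
    (g : ℂ → Fin N → ℂ) (K : Set ℂ) [CompactSpace K] (J : auxA K →L[ℂ] auxA K)
    (y w : ℂ → Fin N → ℂ) (φ : Fin (S + 1) → Fin N → ℂ) : Prop :=
  ∃ (v : Fin N → auxA K) (d : Fin N → ℂ),
    (∀ i (x : K), w x i = (v i : C(K, ℂ)) x) ∧
    (∀ i (x : K), y x i = (J (v i) : C(K, ℂ)) x + d i) ∧
    ∀ x ∈ K, ∀ i, (auxQ p).eval x * w x i + ∑ j, (auxC p B i j).eval x * y x j +
      ∑ k : Fin (S + 1), φ k i * x ^ (k : ℕ) = g x i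

theorem aux_T_eval {N S : ℕ} (p : Fin (S + 2) → ℂ)
    (B : Fin (S + 2) → Matrix (Fin N) (Fin N) ℂ) {K : Set ℂ} [CompactSpace K]
    (J : auxA K →L[ℂ] auxA K) (W : Fin N → auxA K × (Fin (S + 2) → ℂ)) (i : Fin N) (x : K) :
    ((auxP K (auxQ p) * (W i).1 +
      ∑ j, auxP K (auxC p B i j) * (J (W j).1 + (W j).2 (Fin.last (S + 1)) • 1) +
      ∑ k : Fin (S + 1), (W i).2 k.castSucc • auxP K (Polynomial.X ^ (k : ℕ)) : auxA K) :
      C(K, ℂ)) x = (auxQ p).eval (x : ℂ) * ((W i).1 : C(K, ℂ)) x +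
      ∑ j, (auxC p B i j).eval (x : ℂ) * ((J (W j).1 : C(K, ℂ)) x +
        (W j).2 (Fin.last (S + 1))) +
      ∑ k : Fin (S + 1), (W i).2 k.castSucc * (x : ℂ) ^ (k : ℕ) := by
  set ev : auxA K →ₐ[ℂ] ℂ := (ContinuousMap.evalAlgHom ℂ ℂ x).comp (auxA K).val with hev
  have h0 : ∀ f : auxA K, (f : C(K, ℂ)) x = ev f := fun f => rfl
  have h1 : ∀ P : Polynomial ℂ, ev (auxP K P) = P.eval (x : ℂ) := fun P => by
    rw [← h0, auxP_apply]
  simp only [h0, map_add, map_sum, map_mul, map_smul, map_one, h1, smul_eq_mul, mul_one,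
    Polynomial.eval_pow, Polynomial.eval_X]

section
variable {N S : ℕ} {p : Fin (S + 2) → ℂ} {B : Fin (S + 2) → Matrix (Fin N) (Fin N) ℂ}
  {g : ℂ → Fin N → ℂ} {c : ℂ}

theorem AuxSol.restrict {K K' : Set ℂ} [CompactSpace K] [CompactSpace K'] (hKK : K ⊆ K')
    {J : auxA K →L[ℂ] auxA K} (hJ : AuxInt c K J)
    {J' : auxA K' →L[ℂ] auxA K'} (hJ' : AuxInt c K' J')
    {y w : ℂ → Fin N → ℂ} {φ : Fin (S + 1) → Fin N → ℂ}
    (h : AuxSol p B g K' J' y w φ) : AuxSol p B g K J y w φ := by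
  obtain ⟨v, d, h1, h2, h3⟩ := h
  choose v' hv hv' using fun i => aux_J_restrict hKK hJ hJ' (v i)
  refine ⟨v', d, ?_, ?_, fun x hx => h3 x (hKK hx)⟩
  · rintro i ⟨x, hx⟩
    rw [hv, ← h1 i ⟨x, hKK hx⟩]
  · rintro i ⟨x, hx⟩
    rw [hv', ← h2 i ⟨x, hKK hx⟩]

theorem AuxSol.T_eq {K : Set ℂ} [CompactSpace K] {J : auxA K →L[ℂ] auxA K}
    {y w : ℂ → Fin N → ℂ} {φ : Fin (S + 1) → Fin N → ℂ}
    (h : AuxSol p B g K J y w φ) :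
    ∃ W : Fin N → auxA K × (Fin (S + 2) → ℂ),
      (∀ i (x : K), w x i = ((W i).1 : C(K, ℂ)) x) ∧
      (∀ i (x : K), y x i = (J (W i).1 : C(K, ℂ)) x + (W i).2 (Fin.last (S + 1))) ∧
      (∀ i k, φ k i = (W i).2 (Fin.castSucc k)) ∧
      ∀ i (x : K), ((auxP K (auxQ p) * (W i).1 +
      ∑ j, auxP K (auxC p B i j) * (J (W j).1 + (W j).2 (Fin.last (S + 1)) • 1) +
      ∑ k : Fin (S + 1), (W i).2 k.castSucc • auxP K (Polynomial.X ^ (k : ℕ)) : auxA K) :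
      C(K, ℂ)) x = g x i := by
  obtain ⟨v, d, h1, h2, h3⟩ := h
  refine ⟨fun i => (v i, Fin.snoc (fun k => φ k i) (d i)), h1, ?_, ?_, ?_⟩
  · intro i x
    simp only [Fin.snoc_last]
    exact h2 i x
  · intro i k
    simp only [Fin.snoc_castSucc]
  · intro i x
    refine (aux_T_eval p B J (fun i => (v i, Fin.snoc (fun k => φ k i) (d i))) i x).trans ?_
    simp only [Fin.snoc_last, Fin.snoc_castSucc]
    rw [← h3 x x.2 i, ← h1 i x]
    simp only [← h2]

theorem AuxSol.unique (hp : Function.Injective p)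
    (hinv : ∀ k : ℕ, IsUnit ((k : ℂ) • (1 : Matrix (Fin N) (Fin N) ℂ) + ∑ j, B j))
    {K : Set ℂ} [CompactSpace K] (hK : AuxNice c K) (hpK : ∀ j, p j ∈ interior K)
    {J : auxA K →L[ℂ] auxA K} (hJ : AuxInt c K J)
    {y w : ℂ → Fin N → ℂ} {φ : Fin (S + 1) → Fin N → ℂ}
    (h : AuxSol p B g K J y w φ)
    {y' w' : ℂ → Fin N → ℂ} {φ' : Fin (S + 1) → Fin N → ℂ}
    (h' : AuxSol p B g K J y' w' φ') :
    φ = φ' ∧ ∀ x ∈ K, y x = y' x ∧ w x = w' x := by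
  obtain ⟨W, h1, h2, h3, h4⟩ := h.T_eq
  obtain ⟨W', h1', h2', h3', h4'⟩ := h'.T_eq
  have : W = W' := by
    apply (aux_T_bij p hp B hinv hK hpK hJ).1
    funext i
    apply Subtype.ext
    ext x
    exact (h4 i x).trans (h4' i x).symm
  subst this
  refine ⟨?_, fun x hx => ⟨?_, ?_⟩⟩
  · funext k i
    rw [h3, h3']
  · funext i
    rw [h2 i ⟨x, hx⟩, h2' i ⟨x, hx⟩]
  · funext i
    rw [h1 i ⟨x, hx⟩, h1' i ⟨x, hx⟩]

theorem AuxSol.exists (hp : Function.Injective p)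
    (hinv : ∀ k : ℕ, IsUnit ((k : ℂ) • (1 : Matrix (Fin N) (Fin N) ℂ) + ∑ j, B j))
    {D : Set ℂ} (hD : IsOpen D) (hDsc : SimplyConnectedSpace D) (hg : AnalyticOnNhd ℂ g D)
    {K : Set ℂ} [CompactSpace K] (hK : AuxNice c K) (hKD : K ⊆ D)
    (hpK : ∀ j, p j ∈ interior K)
    {J : auxA K →L[ℂ] auxA K} (hJ : AuxInt c K J) :
    ∃ y w φ, AuxSol p B g K J y w φ := by
  classical
  have hgd : ∀ i, DifferentiableOn ℂ (fun x => g x i) D := fun i =>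
    differentiableOn_pi.1 hg.differentiableOn i
  have hgi : ∀ i, ∃ f : auxA K, ∀ x : K, (f : C(K, ℂ)) x = g x i := by
    intro i
    refine ⟨⟨⟨fun x : K => g x i, ?_⟩, ?_⟩, fun x => rfl⟩
    · exact continuousOn_iff_continuous_restrict.1 ((hgd i).continuousOn.mono hKD)
    · exact aux_runge_mem D K hD hDsc hKD _ (hgd i) _ (fun x => rfl)
  choose f hf using hgi
  obtain ⟨W, hW⟩ := (aux_T_bij p hp B hinv hK hpK hJ).2 f
  refine ⟨fun x i => if hx : x ∈ K then
      (J (W i).1 : C(K, ℂ)) ⟨x, hx⟩ + (W i).2 (Fin.last (S + 1)) else 0,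
    fun x i => if hx : x ∈ K then ((W i).1 : C(K, ℂ)) ⟨x, hx⟩ else 0,
    fun k i => (W i).2 k.castSucc, fun i => (W i).1, fun i => (W i).2 (Fin.last (S + 1)),
    ?_, ?_, ?_⟩
  · intro i x
    simp
  · intro i x
    simp
  · intro x hx i
    have := aux_T_eval p B J W i ⟨x, hx⟩
    rw [← hf i ⟨x, hx⟩, ← congrFun hW i]
    rw [this]
    simp [hx]

theorem AuxSol.hasDerivAt {K : Set ℂ} [CompactSpace K]
    {J : auxA K →L[ℂ] auxA K} (hJ : AuxInt c K J)
    {y w : ℂ → Fin N → ℂ} {φ : Fin (S + 1) → Fin N → ℂ}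
    (h : AuxSol p B g K J y w φ) (x : ℂ) (hx : x ∈ interior K) : HasDerivAt y (w x) x := by
  obtain ⟨v, d, h1, h2, h3⟩ := h
  rw [hasDerivAt_pi]
  intro i
  have := aux_J_deriv hJ (v i) (fun x => y x i - d i) (fun x => w x i)
    (fun x => by simp [h2]) (h1 i) x hx
  simpa using this.add_const (d i)

theorem AuxSol.of_holo
    {D : Set ℂ} (hD : IsOpen D) (hDsc : SimplyConnectedSpace D)
    {K : Set ℂ} [CompactSpace K] (hK : AuxNice c K) (hKD : K ⊆ D)
    {J : auxA K →L[ℂ] auxA K} (hJ : AuxInt c K J)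
    {y : ℂ → Fin N → ℂ} {φ : Fin (S + 1) → Fin N → ℂ} (hy : AnalyticOnNhd ℂ y D)
    (he : ∀ x ∈ D, ∀ i, (auxQ p).eval x * deriv y x i + ∑ j, (auxC p B i j).eval x * y x j +
      ∑ k : Fin (S + 1), φ k i * x ^ (k : ℕ) = g x i) :
    AuxSol p B g K J y (deriv y) φ := by
  have hgd : ∀ i, DifferentiableOn ℂ (fun x => deriv y x i) D := fun i =>
    differentiableOn_pi.1 hy.deriv.differentiableOn i
  have hgi : ∀ i, ∃ f : auxA K, ∀ x : K, (f : C(K, ℂ)) x = deriv y x i := by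
    intro i
    refine ⟨⟨⟨fun x : K => deriv y x i, ?_⟩, ?_⟩, fun x => rfl⟩
    · exact continuousOn_iff_continuous_restrict.1 ((hgd i).continuousOn.mono hKD)
    · exact aux_runge_mem D K hD hDsc hKD _ (hgd i) _ (fun x => rfl)
  choose f hf using hgi
  refine ⟨f, fun i => y c i, fun i x => (hf i x).symm, fun i x => ?_, fun x hx => he x (hKD hx)⟩
  rw [aux_J_holo hK hJ (f i) (fun x => y x i) (fun x => deriv y x i) ?_ (fun x => (hf i x).symm) x]
  · simp
  · intro x hx
    exact hasDerivAt_pi.1 (hy x (hKD hx)).differentiableAt.hasDerivAt i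

theorem auxQ_eval {m : ℕ} (p : Fin m → ℂ) (x : ℂ) : (auxQ p).eval x = ∏ j, (x - p j) := by
  simp [auxQ, Polynomial.eval_prod]

theorem auxC_eval (x : ℂ) (hx : x ∉ Set.range p) (i : Fin N) (y : Fin N → ℂ) :
    ∑ j, (auxC p B i j).eval x * y j =
      (∏ j, (x - p j)) * ((∑ j, (x - p j)⁻¹ • B j).mulVec y) i := by
  rw [Matrix.mulVec, dotProduct, Finset.mul_sum]
  refine Finset.sum_congr rfl fun j _ => ?_
  rw [← mul_assoc]
  congr 1
  rw [auxC, Polynomial.eval_finset_sum, Matrix.sum_apply, Finset.mul_sum]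
  refine Finset.sum_congr rfl fun l _ => ?_
  have hl : x - p l ≠ 0 := fun h => hx ⟨l, (sub_eq_zero.1 h).symm⟩
  rw [← Finset.mul_prod_erase Finset.univ (fun j => x - p j) (Finset.mem_univ l)]
  simp only [Polynomial.eval_mul, Polynomial.eval_C, Polynomial.eval_prod, Polynomial.eval_sub,
    Polynomial.eval_X, Matrix.smul_apply, smul_eq_mul]
  field_simp

theorem aux_eq_iff (φ : Fin (S + 1) → Fin N → ℂ) (x : ℂ) (hx : x ∉ Set.range p)
    (y w : Fin N → ℂ) (G : Fin N → ℂ) :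
    (∀ i, (auxQ p).eval x * w i + ∑ j, (auxC p B i j).eval x * y j +
      ∑ k : Fin (S + 1), φ k i * x ^ (k : ℕ) = G i) ↔
    w = ((∏ j, (x - p j))⁻¹ • (G - ∑ i : Fin (S + 1), x ^ (i : ℕ) • φ i)
              - (∑ j, (x - p j)⁻¹ • B j).mulVec y) := by
  have hQ : (∏ j, (x - p j)) ≠ 0 := Finset.prod_ne_zero_iff.2 fun l _ h =>
    hx ⟨l, (sub_eq_zero.1 h).symm⟩
  rw [funext_iff]
  refine forall_congr' fun i => ?_
  rw [auxC_eval x hx, auxQ_eval]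
  have hs : (∑ i : Fin (S + 1), x ^ (i : ℕ) • φ i) i =
      ∑ k : Fin (S + 1), φ k i * x ^ (k : ℕ) := by
    rw [Finset.sum_apply]
    exact Finset.sum_congr rfl fun k _ => by simp [mul_comm]
  rw [Pi.sub_apply, Pi.smul_apply, Pi.sub_apply, hs, smul_eq_mul]
  generalize (∑ k : Fin (S + 1), φ k i * x ^ (k : ℕ)) = s
  generalize ((∑ j, (x - p j)⁻¹ • B j).mulVec y) i = t
  generalize (∏ j, (x - p j)) = q at *
  constructor
  · intro h
    rw [← h]; field_simp; ring
  · intro h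
    rw [h]; field_simp; ring

/-- extension of the polynomial identity through the singular points -/
theorem aux_extend {D : Set ℂ} (hD : IsOpen D) {y : ℂ → Fin N → ℂ}
    {φ : Fin (S + 1) → Fin N → ℂ} (hy : AnalyticOnNhd ℂ y D) (hg : AnalyticOnNhd ℂ g D)
    (he : ∀ x ∈ D \ Set.range p, ∀ i, (auxQ p).eval x * deriv y x i +
      ∑ j, (auxC p B i j).eval x * y x j + ∑ k : Fin (S + 1), φ k i * x ^ (k : ℕ) = g x i) :
    ∀ x ∈ D, ∀ i, (auxQ p).eval x * deriv y x i + ∑ j, (auxC p B i j).eval x * y x j +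
      ∑ k : Fin (S + 1), φ k i * x ^ (k : ℕ) = g x i := by
  intro x hx i
  have hd : ∀ i, ContinuousAt (fun x => deriv y x i) x := fun i =>
    continuousAt_pi.1 (hy.deriv x hx).continuousAt i
  have hyc : ∀ i, ContinuousAt (fun x => y x i) x := fun i =>
    continuousAt_pi.1 (hy x hx).continuousAt i
  have hgc : ContinuousAt (fun x => g x i) x := continuousAt_pi.1 (hg x hx).continuousAt i
  have hL : ContinuousAt (fun x => (auxQ p).eval x * deriv y x i +
      ∑ j, (auxC p B i j).eval x * y x j + ∑ k : Fin (S + 1), φ k i * x ^ (k : ℕ)) x := by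
    refine ContinuousAt.add (ContinuousAt.add ?_ ?_) ?_
    · exact (Polynomial.continuous _).continuousAt.mul (hd i)
    · exact tendsto_finset_sum _ fun j _ => (Polynomial.continuous _).continuousAt.mul (hyc j)
    · exact (by fun_prop : Continuous fun x : ℂ =>
        ∑ k : Fin (S + 1), φ k i * x ^ (k : ℕ)).continuousAt
  have hev : ∀ᶠ z in 𝓝[≠] x, z ∈ D \ Set.range p := by
    have h1 : ∀ᶠ z in 𝓝[≠] x, z ∈ D := nhdsWithin_le_nhds (hD.mem_nhds hx)
    have h2 : ∀ᶠ z in 𝓝[≠] x, z ∉ Set.range p := by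
      have hfin : (Set.range p \ {x}).Finite := (Set.finite_range p).subset Set.diff_subset
      have : ∀ᶠ z in 𝓝 x, z ∈ (Set.range p \ {x})ᶜ :=
        hfin.isClosed.isOpen_compl.mem_nhds (by simp)
      filter_upwards [nhdsWithin_le_nhds this, self_mem_nhdsWithin] with z hz hz' hzp
      exact hz ⟨hzp, hz'⟩
    filter_upwards [h1, h2] with z a b using ⟨a, b⟩
  refine tendsto_nhds_unique (hL.tendsto.mono_left nhdsWithin_le_nhds)
    ((hgc.tendsto.mono_left nhdsWithin_le_nhds : Tendsto _ (𝓝[≠] x) _).congr' ?_)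
  filter_upwards [hev] with z hz
  exact (he z hz i).symm

/-- local data -/
def AuxGood (c : ℂ) (p : Fin (S + 2) → ℂ) (B : Fin (S + 2) → Matrix (Fin N) (Fin N) ℂ)
    (g : ℂ → Fin N → ℂ) (D K : Set ℂ)
    (y w : ℂ → Fin N → ℂ) (φ : Fin (S + 1) → Fin N → ℂ) : Prop :=
  AuxNice c K ∧ (∀ j, p j ∈ interior K) ∧ K ⊆ D ∧
    ∃ (_ : CompactSpace K) (J : auxA K →L[ℂ] auxA K), AuxInt c K J ∧ AuxSol p B g K J y w φ

theorem AuxGood.consistent (hp : Function.Injective p)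
    (hinv : ∀ k : ℕ, IsUnit ((k : ℂ) • (1 : Matrix (Fin N) (Fin N) ℂ) + ∑ j, B j))
    {D : Set ℂ} (hD : IsOpen D) (hDsc : SimplyConnectedSpace D) (hg : AnalyticOnNhd ℂ g D)
    {K K' : Set ℂ} {y w : ℂ → Fin N → ℂ} {φ : Fin (S + 1) → Fin N → ℂ}
    {y' w' : ℂ → Fin N → ℂ} {φ' : Fin (S + 1) → Fin N → ℂ}
    (h : AuxGood c p B g D K y w φ) (h' : AuxGood c p B g D K' y' w' φ') :
    φ = φ' ∧ ∀ x ∈ K ∩ K', y x = y' x ∧ w x = w' x := by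
  obtain ⟨hK, hpK, hKD, i1, J, hJ, hs⟩ := h
  obtain ⟨hK', hpK', hKD', i2, J', hJ', hs'⟩ := h'
  have hU := hK.union hK.mem hK'
  haveI : CompactSpace (K ∪ K' : Set ℂ) := isCompact_iff_compactSpace.1 hU.compact
  obtain ⟨JU, hJU⟩ := aux_J_exists hU
  obtain ⟨Y, V, Φ, hS⟩ := AuxSol.exists (p := p) (B := B) hp hinv hD hDsc hg hU
    (Set.union_subset hKD hKD') (fun j => interior_mono Set.subset_union_left (hpK j)) hJU
  have r1 := AuxSol.unique hp hinv hK hpK hJ hs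
    (hS.restrict Set.subset_union_left hJ hJU)
  have r2 := AuxSol.unique hp hinv hK' hpK' hJ' hs'
    (hS.restrict Set.subset_union_right hJ' hJU)
  refine ⟨r1.1.trans r2.1.symm, fun x hx => ?_⟩
  have a := r1.2 x hx.1
  have b := r2.2 x hx.2
  exact ⟨a.1.trans b.1.symm, a.2.trans b.2.symm⟩

theorem aux_good_exists (hp : Function.Injective p)
    (hinv : ∀ k : ℕ, IsUnit ((k : ℂ) • (1 : Matrix (Fin N) (Fin N) ℂ) + ∑ j, B j))
    {D : Set ℂ} (hD : IsOpen D) (hDc : IsPreconnected D) (hDsc : SimplyConnectedSpace D)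
    (hpD : ∀ j, p j ∈ D) (hc : c ∈ D)
    (hg : AnalyticOnNhd ℂ g D) (x : ℂ) (hx : x ∈ D) :
    ∃ K y w φ, x ∈ interior K ∧ AuxGood c p B g D K y w φ := by
  obtain ⟨K, hK, hKD, hF⟩ := aux_nice_finite D hD hDc c hc (insert x (Set.range p))
    ((Set.finite_range p).insert x) (by
      rintro z (rfl | ⟨j, rfl⟩)
      exacts [hx, hpD j])
  have hpK : ∀ j, p j ∈ interior K := fun j => hF (Or.inr ⟨j, rfl⟩)
  haveI : CompactSpace K := isCompact_iff_compactSpace.1 hK.compact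
  obtain ⟨J, hJ⟩ := aux_J_exists hK
  obtain ⟨y, w, φ, hS⟩ := AuxSol.exists (p := p) (B := B) hp hinv hD hDsc hg hK hKD hpK hJ
  exact ⟨K, y, w, φ, hF (Or.inl rfl), hK, hpK, hKD, inferInstance, J, hJ, hS⟩

end

theorem aux_main (N S : ℕ)
    (p : Fin (S + 2) → ℂ) (hp : Function.Injective p)
    (B : Fin (S + 2) → Matrix (Fin N) (Fin N) ℂ)
    (hinv : ∀ k : ℕ, IsUnit ((k : ℂ) • (1 : Matrix (Fin N) (Fin N) ℂ) + ∑ j, B j))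
    (D : Set ℂ) (hD : IsOpen D) (hDconn : IsPreconnected D)
    (hDsc : SimplyConnectedSpace D) (hpD : ∀ j, p j ∈ D)
    (g : ℂ → Fin N → ℂ) (hg : AnalyticOnNhd ℂ g D) :
    ∃! φ : Fin (S + 1) → Fin N → ℂ,
      ∃ y : ℂ → Fin N → ℂ, AnalyticOnNhd ℂ y D ∧
        ∀ x ∈ D \ Set.range p,
          HasDerivAt y
            ((∏ j, (x - p j))⁻¹ • (g x - ∑ i : Fin (S + 1), x ^ (i : ℕ) • φ i)
              - (∑ j, (x - p j)⁻¹ • B j).mulVec (y x)) x := by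
  classical
  have hc : p 0 ∈ D := hpD 0
  choose! K Y V Φ hxK hgood using fun x hx =>
    aux_good_exists (p := p) (B := B) hp hinv hD hDconn hDsc hpD hc hg x hx
  have hcons : ∀ x ∈ D, ∀ z ∈ D, z ∈ K x → Φ x = Φ z ∧ Y x z = Y z z ∧ V x z = V z z := by
    intro x hx z hz hzx
    have := AuxGood.consistent hp hinv hD hDsc hg (hgood x hx) (hgood z hz)
    exact ⟨this.1, this.2 z ⟨hzx, interior_subset (hxK z hz)⟩⟩
  have hΦ : ∀ x ∈ D, Φ x = Φ (p 0) := fun x hx =>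
    (AuxGood.consistent hp hinv hD hDsc hg (hgood x hx) (hgood _ hc)).1
  have hder : ∀ x ∈ D, HasDerivAt (fun z => Y z z) (V x x) x := by
    intro x hx
    have hG := hgood x hx
    obtain ⟨hK, hpK, hKD, i1, J, hJ, hs⟩ := hG
    refine (hs.hasDerivAt hJ x (hxK x hx)).congr_of_eventuallyEq ?_
    filter_upwards [isOpen_interior.mem_nhds (hxK x hx)] with z hz
    exact (hcons x hx z (hKD (interior_subset hz)) (interior_subset hz)).2.1.symm
  refine ⟨Φ (p 0), ⟨fun z => Y z z, ?_, ?_⟩, ?_⟩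
  · exact DifferentiableOn.analyticOnNhd
      (fun x hx => (hder x hx).differentiableAt.differentiableWithinAt) hD
  · intro x hx
    have h := hder x hx.1
    obtain ⟨hK, hpK, hKD, i1, J, hJ, v, d, h1, h2, h3⟩ := hgood x hx.1
    have h4 := (aux_eq_iff (Φ x) x hx.2 (Y x x) (V x x) (g x)).1
      (h3 x (interior_subset (hxK x hx.1)))
    rw [hΦ x hx.1] at h4
    rw [h4] at h
    exact h
  · rintro φ ⟨y, hy, hyd⟩
    obtain ⟨hK, hpK, hKD, i1, J, hJ, hs⟩ := hgood _ hc
    have he := aux_extend (p := p) (B := B) (φ := φ) hD hy hg (fun x hx =>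
      (aux_eq_iff φ x hx.2 (y x) (deriv y x) (g x)).2 (hyd x hx).deriv)
    exact (AuxSol.unique hp hinv hK hpK hJ (AuxSol.of_holo hD hDsc hK hKD hJ hy he) hs).1

end P6

end AuxPart

open Matrix Set

/-- **Fundamental Lemma** (Lemma 2 of the paper). Given a Fuchsian system
`y' + B(x) y = Q(x)⁻¹ g(x)` with `B(x) = Σ (x - pⱼ)⁻¹ Bⱼ`, `Q(x) = Π (x - pⱼ)`,
under the invertibility condition (INV), for every `g` analytic on a simply connected
domain `D` containing all singularities there is a unique `ℂᴺ`-valued polynomial `φ`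
of degree at most `S` (given by its coefficients `φ 0, …, φ S`) such that
`y' + B(x) y = Q(x)⁻¹ (g(x) - φ(x))` has a solution analytic on all of `D`. -/
theorem stmt_3 (N S : ℕ) (hN : 1 ≤ N)
    (p : Fin (S + 2) → ℂ) (hp : Function.Injective p)
    (B : Fin (S + 2) → Matrix (Fin N) (Fin N) ℂ)
    (hinv : ∀ k : ℕ,
      (∀ j, IsUnit ((k : ℂ) • (1 : Matrix (Fin N) (Fin N) ℂ) + B j)) ∧
        IsUnit ((k : ℂ) • (1 : Matrix (Fin N) (Fin N) ℂ) + ∑ j, B j))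
    (D : Set ℂ) (hD : IsOpen D) (hDconn : IsPreconnected D)
    (hDsc : SimplyConnectedSpace D) (hpD : ∀ j, p j ∈ D)
    (g : ℂ → Fin N → ℂ) (hg : AnalyticOnNhd ℂ g D) :
    ∃! φ : Fin (S + 1) → Fin N → ℂ,
      ∃ y : ℂ → Fin N → ℂ, AnalyticOnNhd ℂ y D ∧
        ∀ x ∈ D \ Set.range p,
          HasDerivAt y
            ((∏ j, (x - p j))⁻¹ • (g x - ∑ i : Fin (S + 1), x ^ (i : ℕ) • φ i)
              - (∑ j, (x - p j)⁻¹ • B j) *ᵥ y x) x := by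
  exact aux_main N S p hp B (fun k => (hinv k).2) D hD hDconn hDsc hpD g hg
end

section
/- Fix j ∈ {0, 1, …, S+1} and assume that k·I + B_j is invertible for every k ∈ ℕ. Then for every ℂ^N-valued function g analytic in a neighborhood of p_j, the equation y'(x) + B(x) y(x) = Q(x)^{−1} g(x) has a unique solution y(x) which is analytic at the singular point x = p_j. -/
open Matrix Set Filter

/-- `IsLocalSolutionAt N S p B g j V y U` : `y` is analytic on the open neighborhood
`U ⊆ V` of `p j` (containing no other singularity) and solves
`y' + B(x) y = Q(x)⁻¹ g(x)` on `U \ {p j}`. -/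
def IsLocalSolutionAt (N S : ℕ) (p : Fin (S + 2) → ℂ)
    (B : Fin (S + 2) → Matrix (Fin N) (Fin N) ℂ) (g : ℂ → Fin N → ℂ)
    (j : Fin (S + 2)) (V : Set ℂ) (y : ℂ → Fin N → ℂ) (U : Set ℂ) : Prop :=
  IsOpen U ∧ p j ∈ U ∧ U ⊆ V ∧ (∀ k, k ≠ j → p k ∉ U) ∧
    AnalyticOnNhd ℂ y U ∧
    ∀ x ∈ U \ {p j},
      HasDerivAt y
        ((∏ l, (x - p l))⁻¹ • g x - (∑ l, (x - p l)⁻¹ • B l) *ᵥ y x) x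

/-- Coefficients of the formal power series solution. -/
noncomputable def solCoeff {R : Type*} [Ring R] (X A F : ℕ → R) : ℕ → R
  | n => X n * (F n - ∑ m : Fin n, A (n - m) * solCoeff X A F m)
termination_by n => n
decreasing_by exact m.2

theorem solCoeff_eq {R : Type*} [Ring R] (X A F : ℕ → R) (n : ℕ) :
    solCoeff X A F n = X n * (F n - ∑ m ∈ Finset.range n, A (n - m) * solCoeff X A F m) := by
  rw [solCoeff, Finset.sum_range]

theorem geom_aux (a c : ℝ) (ha : 0 < a) (hc : 0 ≤ c) (n : ℕ) :
    c * ∑ m ∈ Finset.range n, a ^ (n - m) * (a + c * a) ^ m ≤ (a + c * a) ^ n := by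
  suffices h : c * ∑ m ∈ Finset.range n, a ^ (n - m) * (a + c * a) ^ m
      = (a + c * a) ^ n - a ^ n by
    rw [h]; linarith [pow_pos ha n]
  induction n with
  | zero => simp
  | succ n ih =>
    rw [Finset.sum_range_succ]
    have : ∑ m ∈ Finset.range n, a ^ (n + 1 - m) * (a + c * a) ^ m
        = a * ∑ m ∈ Finset.range n, a ^ (n - m) * (a + c * a) ^ m := by
      rw [Finset.mul_sum]
      refine Finset.sum_congr rfl fun m hm => ?_
      have := Finset.mem_range.1 hm
      rw [Nat.succ_sub (by omega), pow_succ]; ring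
    rw [this, mul_add, mul_left_comm, ih, Nat.add_sub_cancel_left]
    ring

theorem solCoeff_bound {R : Type*} [NormedRing R] (X A F : ℕ → R) (K M a : ℝ)
    (hK : 0 < K) (hM : 0 < M) (ha : 0 < a) (hX : ∀ n, ‖X n‖ ≤ K)
    (hA : ∀ n, ‖A n‖ ≤ M * a ^ n) (hF : ∀ n, ‖F n‖ ≤ M * a ^ n) (n : ℕ) :
    ‖solCoeff X A F n‖ ≤ (2 * K * M) * (a + (2 * K * M) * a) ^ n := by
  induction n using Nat.strong_induction_on with
  | _ n ih =>
  rw [solCoeff_eq]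
  have hab : a ^ n ≤ (a + (2 * K * M) * a) ^ n := by
    gcongr
    have : 0 < 2 * K * M * a := by positivity
    linarith
  have h1 : ‖∑ m ∈ Finset.range n, A (n - m) * solCoeff X A F m‖
      ≤ M * ((2 * K * M) *
        ∑ m ∈ Finset.range n, a ^ (n - m) * (a + (2 * K * M) * a) ^ m) := by
    refine (norm_sum_le _ _).trans ?_
    rw [Finset.mul_sum, Finset.mul_sum]
    refine Finset.sum_le_sum fun m hm => ?_
    refine (norm_mul_le _ _).trans ?_
    calc _ ≤ (M * a ^ (n - m)) * ((2 * K * M) * (a + (2 * K * M) * a) ^ m) := by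
          gcongr
          · exact hA _
          · exact ih m (Finset.mem_range.1 hm)
      _ = _ := by ring
  have h2 := geom_aux a (2 * K * M) ha (by positivity) n
  calc _ ≤ ‖X n‖ * (‖F n‖ + ‖∑ m ∈ Finset.range n, A (n - m) * solCoeff X A F m‖) := by
        refine (norm_mul_le _ _).trans ?_
        gcongr
        exact norm_sub_le _ _
    _ ≤ K * (M * (a + (2 * K * M) * a) ^ n + M * (a + (2 * K * M) * a) ^ n) := by
        gcongr
        · exact hX n
        · exact (hF n).trans (by gcongr)
        · exact h1.trans (by gcongr)
    _ = _ := by ring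

theorem inv_bound {R : Type*} [NormedRing R] [NormedAlgebra ℂ R] (a : R) (X : ℕ → R)
    (hX : ∀ n : ℕ, ((n : ℂ) • (1 : R) + a) * X n = 1) : ∃ K, 0 < K ∧ ∀ n, ‖X n‖ ≤ K := by
  have h : ∀ n : ℕ, ‖a‖ + 1 ≤ n → ‖X n‖ ≤ ‖(1 : R)‖ := by
    intro n hn
    have h1 : (n : ℂ) • X n = 1 - a * X n := by
      rw [← hX n, add_mul, smul_mul_assoc, one_mul]; abel
    have h2 := congrArg norm h1
    rw [norm_smul, Complex.norm_natCast] at h2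
    have h3 := norm_sub_le (1 : R) (a * X n)
    have h4 := norm_mul_le a (X n)
    nlinarith [norm_nonneg (X n)]
  have hb : BddAbove (Set.range fun n => ‖X n‖) := by
    refine Filter.IsBoundedUnder.bddAbove_range ⟨‖(1 : R)‖, ?_⟩
    rw [eventually_map]
    obtain ⟨n0, hn0⟩ := exists_nat_ge (‖a‖ + 1)
    filter_upwards [eventually_ge_atTop n0] with n hn
    exact h n (hn0.trans (by exact_mod_cast hn))
  obtain ⟨K, hK⟩ := hb
  exact ⟨max K 1, by positivity, fun n => (hK ⟨n, rfl⟩).trans (le_max_left _ _)⟩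

theorem coeff_bound {R : Type*} [NormedRing R] [NormedAlgebra ℂ R] {A : ℂ → R}
    (hA : AnalyticAt ℂ A 0) : ∃ (c : ℕ → R) (M a : ℝ), 0 < M ∧ 0 < a ∧
      (∀ n, ‖c n‖ ≤ M * a ^ n) ∧ c 0 = A 0 ∧
      ∀ᶠ t in nhds (0 : ℂ), HasSum (fun n => t ^ n • c n) (A t) := by
  obtain ⟨q, hq⟩ := hA
  obtain ⟨M, a, hM, ha, hb⟩ := q.le_mul_pow_of_radius_pos hq.radius_pos
  have hs := hasFPowerSeriesAt_iff.1 hq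
  simp only [zero_add] at hs
  refine ⟨q.coeff, M, a, hM, ha, fun n => ?_, ?_, hs⟩
  · rw [← FormalMultilinearSeries.norm_apply_eq_norm_coef]; exact hb n
  · exact hq.coeff_zero _

theorem exists_sol {R : Type*} [NormedRing R] [NormedAlgebra ℂ R] [CompleteSpace R]
    {A F : ℂ → R} (hA : AnalyticAt ℂ A 0) (hF : AnalyticAt ℂ F 0)
    (hu : ∀ n : ℕ, IsUnit ((n : ℂ) • (1 : R) + A 0)) :
    ∃ Y : ℂ → R, AnalyticAt ℂ Y 0 ∧
      ∀ᶠ t in nhds (0 : ℂ), t • deriv Y t + A t * Y t = F t := by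
  obtain ⟨c, M₁, a₁, hM₁, ha₁, hc, hc0, hcs⟩ := coeff_bound hA
  obtain ⟨f, M₂, a₂, hM₂, ha₂, hf, -, hfs⟩ := coeff_bound hF
  choose X hX using fun n => (hu n).exists_right_inv
  obtain ⟨K, hK, hXK⟩ := inv_bound _ X hX
  set M := max M₁ M₂
  set a := max a₁ a₂
  have hM : 0 < M := lt_max_of_lt_left hM₁
  have ha : 0 < a := lt_max_of_lt_left ha₁
  have hc' : ∀ n, ‖c n‖ ≤ M * a ^ n := fun n => (hc n).trans (by
    gcongr
    · exact le_max_left _ _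
    · exact le_max_left _ _)
  have hf' : ∀ n, ‖f n‖ ≤ M * a ^ n := fun n => (hf n).trans (by
    gcongr
    · exact le_max_right _ _
    · exact le_max_right _ _)
  have hy := solCoeff_bound X c f K M a hK hM ha hXK hc' hf'
  have hrec : ∀ n : ℕ, (n : ℂ) • solCoeff X c f n
      + ∑ m ∈ Finset.range (n + 1), c m * solCoeff X c f (n - m) = f n := by
    intro n
    have h1 : ((n : ℂ) • (1 : R) + A 0) * solCoeff X c f n
        = f n - ∑ m ∈ Finset.range n, c (n - m) * solCoeff X c f m := by
      conv_lhs => rw [solCoeff_eq, ← mul_assoc, hX, one_mul]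
    have h2 : ∑ m ∈ Finset.range (n + 1), c m * solCoeff X c f (n - m)
        = ∑ m ∈ Finset.range (n + 1), c (n - m) * solCoeff X c f m := by
      rw [← Finset.sum_range_reflect]
      refine Finset.sum_congr rfl fun m hm => ?_
      have := Finset.mem_range.1 hm
      congr 2; omega
    rw [h2, Finset.sum_range_succ, Nat.sub_self, hc0]
    rw [add_mul, smul_mul_assoc, one_mul] at h1
    rw [eq_sub_iff_add_eq] at h1
    rw [← h1]; abel
  generalize solCoeff X c f = y at hy hrec
  set D := 2 * K * M
  set b := a + D * a
  have hD : 0 < D := by positivity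
  have hb : 0 < b := by positivity
  have hab : a ≤ b := by
    have : 0 < D * a := by positivity
    simp only [b]; linarith
  set r : ℝ := 1 / (2 * b) with hr
  have hr0 : 0 < r := by positivity
  have hrb : r * b = 1 / 2 := by rw [hr]; field_simp
  have hpow : ∀ (t : ℂ), ‖t‖ < r → ∀ n : ℕ, ‖t‖ ^ n * b ^ n ≤ (1 / 2) ^ n := by
    intro t ht n
    rw [← mul_pow, ← hrb]; gcongr
  have hgeo : Summable fun n : ℕ => ((1 : ℝ) / 2) ^ n := summable_geometric_two
  have hngeo : Summable fun n : ℕ => (n : ℝ) * (1 / 2) ^ n := by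
    simpa using summable_pow_mul_geometric_of_norm_lt_one (R := ℝ) 1 (r := 1 / 2) (by norm_num)
  have hcn : ∀ t : ℂ, ‖t‖ < r → Summable fun n => ‖t ^ n • c n‖ := by
    intro t ht
    refine Summable.of_nonneg_of_le (fun _ => norm_nonneg _) (fun n => ?_) (hgeo.mul_left M)
    rw [norm_smul, norm_pow]
    calc _ ≤ ‖t‖ ^ n * (M * b ^ n) := by
          gcongr
          exact (hc' n).trans (by gcongr)
      _ = M * (‖t‖ ^ n * b ^ n) := by ring
      _ ≤ _ := by gcongr; exact hpow t ht n
  have hyn : ∀ t : ℂ, ‖t‖ < r → Summable fun n => ‖t ^ n • y n‖ := by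
    intro t ht
    refine Summable.of_nonneg_of_le (fun _ => norm_nonneg _) (fun n => ?_) (hgeo.mul_left D)
    rw [norm_smul, norm_pow]
    calc _ ≤ ‖t‖ ^ n * (D * b ^ n) := by
          gcongr
          exact hy n
      _ = D * (‖t‖ ^ n * b ^ n) := by ring
      _ ≤ _ := by gcongr; exact hpow t ht n
  have hbd : ∀ (n : ℕ) (t : ℂ), t ∈ Metric.ball (0 : ℂ) r →
      ‖((n : ℂ) * t ^ (n - 1)) • y n‖ ≤ (D * (2 * b)) * ((n : ℝ) * (1 / 2) ^ n) := by
    intro n t ht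
    have ht : ‖t‖ < r := by simpa using ht
    rcases n with _ | n
    · simp
    rw [norm_smul, norm_mul, norm_pow, Complex.norm_natCast, Nat.add_sub_cancel]
    calc _ ≤ ((n + 1 : ℕ) : ℝ) * ‖t‖ ^ n * (D * b ^ (n + 1)) := by
          gcongr
          exact hy _
      _ = D * b * ((n + 1 : ℕ) : ℝ) * (‖t‖ ^ n * b ^ n) := by ring
      _ ≤ D * b * ((n + 1 : ℕ) : ℝ) * (1 / 2) ^ n := by gcongr; exact hpow t ht n
      _ = _ := by ring
  have hder : ∀ t ∈ Metric.ball (0 : ℂ) r, HasDerivAt (fun z => ∑' n, z ^ n • y n)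
      (∑' n : ℕ, ((n : ℂ) * t ^ (n - 1)) • y n) t := by
    intro t ht
    refine hasDerivAt_tsum_of_isPreconnected (hngeo.mul_left (D * (2 * b))) Metric.isOpen_ball
      (convex_ball (0 : ℂ) r).isPreconnected (fun n z _ => (hasDerivAt_pow n z).smul_const (y n))
      hbd ht ?_ ht
    exact (hyn t (by simpa using ht)).of_norm
  refine ⟨fun z => ∑' n, z ^ n • y n, ?_, ?_⟩
  · refine DifferentiableOn.analyticAt (s := Metric.ball 0 r)
      (fun t ht => (hder t ht).differentiableAt.differentiableWithinAt)
      (Metric.ball_mem_nhds _ hr0)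
  · filter_upwards [hcs, hfs, Metric.ball_mem_nhds (0 : ℂ) hr0] with t h1 h2 ht
    have ht' : ‖t‖ < r := by simpa using ht
    rw [(hder t ht).deriv]
    have s1 : HasSum (fun n : ℕ => t • (((n : ℂ) * t ^ (n - 1)) • y n))
        (t • ∑' n : ℕ, ((n : ℂ) * t ^ (n - 1)) • y n) :=
      (Summable.of_norm_bounded (hngeo.mul_left (D * (2 * b)))
        (fun n => hbd n t ht)).hasSum.const_smul t
    have s2 := hasSum_sum_range_mul_of_summable_norm (hcn t ht') (hyn t ht')
    rw [h1.tsum_eq] at s2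
    refine (s1.add s2).unique ?_
    convert h2 using 2 with n
    rw [← hrec n, smul_add, Finset.smul_sum]
    congr 1
    · rw [smul_smul, smul_smul]
      congr 1
      rcases n with _ | n
      · simp
      · rw [Nat.add_sub_cancel]; ring
    · refine Finset.sum_congr rfl fun m hm => ?_
      have := Finset.mem_range.1 hm
      rw [smul_mul_smul_comm, ← pow_add]
      congr 2; omega

/-- The regular part of the coefficient, in the coordinate `t = x - p j`. -/
noncomputable def regA {N S : ℕ} (p : Fin (S + 2) → ℂ)
    (B : Fin (S + 2) → Matrix (Fin N) (Fin N) ℂ) (j : Fin (S + 2)) (x : ℂ) :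
    Matrix (Fin N) (Fin N) ℂ :=
  B j + (x - p j) • ∑ l ∈ Finset.univ.erase j, (x - p l)⁻¹ • B l

theorem regA_eq {N S : ℕ} (p : Fin (S + 2) → ℂ)
    (B : Fin (S + 2) → Matrix (Fin N) (Fin N) ℂ) (j : Fin (S + 2)) (x : ℂ) (hx : x ≠ p j) :
    (x - p j) • ∑ l, (x - p l)⁻¹ • B l = regA p B j x := by
  rw [regA, ← Finset.add_sum_erase _ _ (Finset.mem_univ j), smul_add, smul_smul,
    mul_inv_cancel₀ (sub_ne_zero.2 hx), one_smul]

theorem regQ_eq {S : ℕ} (p : Fin (S + 2) → ℂ) (j : Fin (S + 2)) (x : ℂ) (hx : x ≠ p j) :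
    (x - p j) * (∏ l, (x - p l))⁻¹ = (∏ l ∈ Finset.univ.erase j, (x - p l))⁻¹ := by
  rw [← Finset.mul_prod_erase _ _ (Finset.mem_univ j), mul_inv,
    mul_inv_cancel_left₀ (sub_ne_zero.2 hx)]

section
attribute [local instance] Matrix.linftyOpNormedRing Matrix.linftyOpNormedAlgebra

theorem regA_analytic {N S : ℕ} (p : Fin (S + 2) → ℂ) (hp : Function.Injective p)
    (B : Fin (S + 2) → Matrix (Fin N) (Fin N) ℂ) (j : Fin (S + 2)) :
    AnalyticAt ℂ (regA p B j) (p j) := by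
  unfold regA
  refine analyticAt_const.add ((analyticAt_id.sub analyticAt_const).smul ?_)
  refine Finset.analyticAt_fun_sum _ fun l hl => ?_
  refine AnalyticAt.smul (AnalyticAt.inv (analyticAt_id.sub analyticAt_const) ?_) analyticAt_const
  exact sub_ne_zero.2 fun h => (Finset.ne_of_mem_erase hl) (hp h).symm

theorem regA_tendsto {N S : ℕ} (p : Fin (S + 2) → ℂ) (hp : Function.Injective p)
    (B : Fin (S + 2) → Matrix (Fin N) (Fin N) ℂ) (j : Fin (S + 2)) :
    ContinuousAt (regA p B j) (p j) := (regA_analytic p hp B j).continuousAt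

theorem exists_sol_matrix {N S : ℕ} (hN : 1 ≤ N)
    (p : Fin (S + 2) → ℂ) (hp : Function.Injective p)
    (B : Fin (S + 2) → Matrix (Fin N) (Fin N) ℂ) (j : Fin (S + 2))
    (hinv : ∀ k : ℕ, IsUnit ((k : ℂ) • (1 : Matrix (Fin N) (Fin N) ℂ) + B j))
    (f : ℂ → Fin N → ℂ) (hf : AnalyticAt ℂ f (p j)) :
    ∃ y : ℂ → Fin N → ℂ, AnalyticAt ℂ y (p j) ∧
      ∀ᶠ x in nhds (p j), (x - p j) • deriv y x + regA p B j x *ᵥ y x = f x := by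
  let e : Fin N → ℂ := Pi.single ⟨0, hN⟩ 1
  have hee : e ⬝ᵥ e = 1 := by simp [e]
  let L : (Fin N → ℂ) →L[ℂ] Matrix (Fin N) (Fin N) ℂ := LinearMap.toContinuousLinearMap
    { toFun := fun v => vecMulVec v e
      map_add' := fun v w => by simp [add_vecMulVec]
      map_smul' := fun c v => by simp [smul_vecMulVec] }
  let L' : Matrix (Fin N) (Fin N) ℂ →L[ℂ] (Fin N → ℂ) := LinearMap.toContinuousLinearMap
    { toFun := fun M => M *ᵥ e
      map_add' := fun v w => by simp [add_mulVec]
      map_smul' := fun c v => by simp [smul_mulVec] }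
  have hLL : ∀ v, L' (L v) = v := by
    intro v
    change vecMulVec v e *ᵥ e = v
    ext i
    simp [vecMulVec_mulVec, hee]
  have hL'mul : ∀ M M', L' (M * M') = M *ᵥ L' M' := by
    intro M M'
    exact (mulVec_mulVec e M M').symm
  have hsh : AnalyticAt ℂ (fun t : ℂ => p j + t) 0 := analyticAt_const.add analyticAt_id
  have hA : AnalyticAt ℂ (fun t : ℂ => regA p B j (p j + t)) 0 :=
    AnalyticAt.fun_comp (by simpa using regA_analytic p hp B j) hsh
  have hF : AnalyticAt ℂ (fun t : ℂ => L (f (p j + t))) 0 :=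
    (L.analyticAt _).fun_comp (AnalyticAt.fun_comp (by simpa using hf) hsh)
  obtain ⟨Y, hY, hYs⟩ := exists_sol hA hF (by simpa [regA] using hinv)
  have hsh' : AnalyticAt ℂ (fun x : ℂ => x - p j) (p j) := analyticAt_id.sub analyticAt_const
  refine ⟨fun x => L' (Y (x - p j)), ?_, ?_⟩
  · exact (L'.analyticAt _).fun_comp (AnalyticAt.fun_comp (by simpa using hY) hsh')
  · have ht : Tendsto (fun x : ℂ => x - p j) (nhds (p j)) (nhds 0) := by
      simpa using hsh'.continuousAt.tendsto
    filter_upwards [ht.eventually hYs, ht.eventually hY.eventually_analyticAt] with x h1 h2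
    have hd : HasDerivAt (fun x => L' (Y (x - p j))) (L' (deriv Y (x - p j))) x :=
      L'.hasFDerivAt.comp_hasDerivAt x (h2.differentiableAt.hasDerivAt.comp_sub_const x (p j))
    rw [hd.deriv]
    have := congrArg L' h1
    rw [map_add, map_smul, hL'mul, hLL] at this
    rw [add_sub_cancel] at this
    exact this

end

theorem sol_unique {N S : ℕ}
    (p : Fin (S + 2) → ℂ) (hp : Function.Injective p)
    (B : Fin (S + 2) → Matrix (Fin N) (Fin N) ℂ) (j : Fin (S + 2))
    (hinv : ∀ k : ℕ, IsUnit ((k : ℂ) • (1 : Matrix (Fin N) (Fin N) ℂ) + B j))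
    (z : ℂ → Fin N → ℂ) (hz : AnalyticAt ℂ z (p j))
    (hd : ∀ᶠ x in nhdsWithin (p j) {p j}ᶜ,
      HasDerivAt z (-((∑ l, (x - p l)⁻¹ • B l) *ᵥ z x)) x) :
    ∀ᶠ x in nhds (p j), z x = 0 := by
  by_contra hne
  obtain ⟨n, w, hw, hw0, hzw⟩ := (hz.exists_eventuallyEq_pow_smul_nonzero_iff).2 hne
  apply hw0
  have hlim : Tendsto (fun x => (n : ℂ) • w x + (x - p j) • deriv w x + regA p B j x *ᵥ w x)
      (nhdsWithin (p j) {p j}ᶜ)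
      (nhds ((n : ℂ) • w (p j) + (p j - p j) • deriv w (p j) + regA p B j (p j) *ᵥ w (p j))) := by
    apply ContinuousAt.continuousWithinAt
    have h1 := hw.continuousAt
    have h2 := hw.deriv.continuousAt
    have h3 := regA_tendsto p hp B j
    have h4 : ContinuousAt (fun x => regA p B j x *ᵥ w x) (p j) :=
      (Continuous.matrix_mulVec continuous_fst continuous_snd).continuousAt.comp
        (f := fun x => (regA p B j x, w x)) (h3.prodMk h1)
    fun_prop
  have hzero : ∀ᶠ x in nhdsWithin (p j) {p j}ᶜ,
      (n : ℂ) • w x + (x - p j) • deriv w x + regA p B j x *ᵥ w x = 0 := by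
    filter_upwards [hd, hzw.eventually_nhds.filter_mono nhdsWithin_le_nhds,
      hw.eventually_analyticAt.filter_mono nhdsWithin_le_nhds, self_mem_nhdsWithin]
      with x h1 h2 h3 hx
    have hx : x ≠ p j := hx
    have hx' := sub_ne_zero.2 hx
    have e1 : HasDerivAt z _ x := (((((hasDerivAt_id x).sub_const (p j)).pow n).smul
      h3.differentiableAt.hasDerivAt)).congr_of_eventuallyEq h2
    have e2 := h1.unique e1
    have e3 : (x - p j) • -((∑ l, (x - p l)⁻¹ • B l) *ᵥ z x)
        = (x - p j) • ((x - p j) ^ n • deriv w x + ((n : ℂ) * (x - p j) ^ (n - 1)) • w x) := by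
      rw [e2]; simp
    rw [smul_neg, ← smul_mulVec, regA_eq p B j x hx, h2.self_of_nhds, mulVec_smul] at e3
    have e4 : (x - p j) ^ n • ((n : ℂ) • w x + (x - p j) • deriv w x + regA p B j x *ᵥ w x) = 0 := by
      have e5 : (x - p j) • ((n : ℂ) * (x - p j) ^ (n - 1)) • w x
          = (x - p j) ^ n • (n : ℂ) • w x := by
        rw [smul_smul, smul_smul]
        congr 1
        rcases n with _ | n
        · simp
        · rw [Nat.add_sub_cancel]; ring
      rw [smul_add, e5, smul_comm (x - p j)] at e3
      rw [smul_add, smul_add, add_comm ((x - p j) ^ n • (n : ℂ) • w x), ← e3]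
      exact neg_add_cancel _
    exact (smul_eq_zero.1 e4).resolve_left (pow_ne_zero _ hx')
  have h0 := tendsto_nhds_unique hlim (tendsto_const_nhds.congr' (hzero.mono fun _ h => h.symm))
  have h1 : ((n : ℂ) • (1 : Matrix (Fin N) (Fin N) ℂ) + B j) *ᵥ w (p j) = 0 := by
    simpa [regA, add_mulVec, smul_mulVec] using h0
  obtain ⟨X, hX⟩ := (hinv n).exists_left_inv
  have := congrArg (fun v => X *ᵥ v) h1
  simpa [mulVec_mulVec, hX] using this

theorem stmt_4 (N S : ℕ) (hN : 1 ≤ N)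
    (p : Fin (S + 2) → ℂ) (hp : Function.Injective p)
    (B : Fin (S + 2) → Matrix (Fin N) (Fin N) ℂ)
    (j : Fin (S + 2))
    (hinv : ∀ k : ℕ, IsUnit ((k : ℂ) • (1 : Matrix (Fin N) (Fin N) ℂ) + B j))
    (V : Set ℂ) (hV : IsOpen V) (hpV : p j ∈ V)
    (g : ℂ → Fin N → ℂ) (hg : AnalyticOnNhd ℂ g V) :
    (∃ y U, IsLocalSolutionAt N S p B g j V y U) ∧
      ∀ y₁ U₁ y₂ U₂, IsLocalSolutionAt N S p B g j V y₁ U₁ →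
        IsLocalSolutionAt N S p B g j V y₂ U₂ → y₁ =ᶠ[nhds (p j)] y₂ := by
  constructor
  · have hf : AnalyticAt ℂ
        (fun x => (∏ l ∈ Finset.univ.erase j, (x - p l))⁻¹ • g x) (p j) := by
      refine AnalyticAt.fun_smul (AnalyticAt.fun_inv ?_ ?_) (hg _ hpV)
      · exact Finset.analyticAt_fun_prod _ fun l _ => analyticAt_id.sub analyticAt_const
      · refine Finset.prod_ne_zero_iff.2 fun l hl => ?_
        exact sub_ne_zero.2 fun h => (Finset.ne_of_mem_erase hl) (hp h).symm
    obtain ⟨y, hy, hys⟩ := exists_sol_matrix hN p hp B j hinv _ hf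
    have hother : ∀ᶠ x in nhds (p j), ∀ k, k ≠ j → p k ≠ x := by
      rw [eventually_all]
      intro k
      by_cases hk : k = j
      · simp [hk]
      · have : ∀ᶠ x in nhds (p j), x ≠ p k := eventually_ne_nhds fun h => hk (hp h).symm
        exact this.mono fun x hx _ h => hx h.symm
    obtain ⟨U, hU, hUo, hpU⟩ := eventually_nhds_iff.1
      ((hother.and (hV.eventually_mem hpV)).and (hys.and hy.eventually_analyticAt))
    refine ⟨y, U, hUo, hpU, fun x hx => (hU x hx).1.2, fun k hk hkU => (hU _ hkU).1.1 k hk rfl,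
      fun x hx => (hU x hx).2.2, ?_⟩
    rintro x ⟨hx, hxj⟩
    have hxj : x ≠ p j := hxj
    have hd := (hU x hx).2.2.differentiableAt.hasDerivAt
    have h := (hU x hx).2.1
    refine hd.congr_deriv ?_
    apply smul_right_injective _ (sub_ne_zero.2 hxj)
    simp only
    rw [smul_sub, smul_smul, regQ_eq p j x hxj, ← smul_mulVec, regA_eq p B j x hxj, ← h]
    abel
  · rintro y₁ U₁ y₂ U₂ ⟨ho₁, hm₁, -, -, ha₁, hd₁⟩ ⟨ho₂, hm₂, -, -, ha₂, hd₂⟩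
    have := sol_unique p hp B j hinv (fun x => y₁ x - y₂ x) ((ha₁ _ hm₁).sub (ha₂ _ hm₂)) (by
      filter_upwards [(ho₁.eventually_mem hm₁).filter_mono nhdsWithin_le_nhds,
        (ho₂.eventually_mem hm₂).filter_mono nhdsWithin_le_nhds, self_mem_nhdsWithin]
        with x h1 h2 hx
      refine ((hd₁ x ⟨h1, hx⟩).sub (hd₂ x ⟨h2, hx⟩)).congr_deriv ?_
      rw [mulVec_sub]; abel)
    exact this.mono fun x hx => sub_eq_zero.1 hx
end
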